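/- arXiv:2605.24610 — 4 statements merged into one kernel-verified Lean document; each statement's English description precedes it below -/
import Mathlib

section
/- Define F₂ : ℝ² → ℝ⁵ by F₂(x,y) = (2cos x − (1+sin y)sin x, 2sin x + (1+sin y)cos x, cos(2x+y) − (1/2)sin(2x), sin(2x+y) + (1/2)cos(2x), cos y). Then F₂ is free: for every (x,y) ∈ ℝ², the five vectors ∂ₓF₂, ∂ᵧF₂, ∂ₓₓF₂, ∂ₓᵧF₂, ∂ᵧᵧF₂ ∈ ℝ⁵ are linearly independent. Since F₂ is 2π-periodic in each variable, it induces a smooth free map of the 2-torus T² into ℝ⁵, which is the critical dimension q₂ = 2·(2+3)/2 = 5. -/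
open Real

/-- The explicit map `F₂ : ℝ² → ℝ⁵`. -/
noncomputable def F₂ (x y : ℝ) : Fin 5 → ℝ :=
  ![2 * cos x - (1 + sin y) * sin x,
    2 * sin x + (1 + sin y) * cos x,
    cos (2 * x + y) - (1 / 2) * sin (2 * x),
    sin (2 * x + y) + (1 / 2) * cos (2 * x),
    cos y]

/-- The determinant deciding freeness of `F₂` (with `c = cos y`, `s = sin y`) is positive. -/
lemma freeness_det_pos {c s : ℝ} (h : c ^ 2 + s ^ 2 = 1) :
    0 < -(1 + s) * (8 * c * s - 2 * c * (3 * s + 1)) + (2 * s + 1) * (4 * s - c * (3 * s + 1))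
      + (2 * c - 2) * (4 * c - 4 * c ^ 2) := by
  have key : -(1 + s) * (8 * c * s - 2 * c * (3 * s + 1)) +
      (2 * s + 1) * (4 * s - c * (3 * s + 1)) + (2 * c - 2) * (4 * c - 4 * c ^ 2)
      = (s + 2 - 5 / 2 * c) ^ 2 + 11 / 4 * (c - 10 / 11) ^ 2 + 8 / 11 := by
    linear_combination (7 - 8 * c) * h
  rw [key]
  positivity

/-- The linear system obtained from the free condition by rotating away the dependence on `x`
has only the trivial solution. -/
lemma rotated_system_trivial {c s g₀ g₁ g₂ g₃ g₄ : ℝ} (h : c ^ 2 + s ^ 2 = 1)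
    (h₁ : -(1 + s) * g₀ - 2 * g₂ - c * g₃ = 0)
    (h₂ : 2 * g₀ + c * g₁ - (1 + s) * g₂ - s * g₄ = 0)
    (h₃ : -(2 * s + 1) * g₀ - s * g₁ - 4 * c * g₂ - 2 * c * g₃ - c * g₄ = 0)
    (h₄ : 2 * c * g₀ + c * g₁ - (4 * s + 2) * g₂ - 2 * s * g₃ - s * g₄ = 0)
    (h₅ : -s * g₁ - c * g₄ = 0) :
    g₀ = 0 ∧ g₁ = 0 ∧ g₂ = 0 ∧ g₃ = 0 ∧ g₄ = 0 := by
  have hD := (freeness_det_pos h).ne'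
  have r₃ : -(2 * s + 1) * g₀ - 4 * c * g₂ - 2 * c * g₃ = 0 := by linear_combination h₃ - h₅
  have r₄ : (2 * c - 2) * g₀ - (3 * s + 1) * g₂ - 2 * s * g₃ = 0 := by
    linear_combination h₄ - h₂
  have e₀ : g₀ = 0 := (mul_eq_zero.mp (by
    linear_combination (8 * c * s - 2 * c * (3 * s + 1)) * h₁
      + (c * (3 * s + 1) - 4 * s) * r₃ + (4 * c - 4 * c ^ 2) * r₄)).resolve_left hD
  have e₂ : g₂ = 0 := (mul_eq_zero.mp (by
    linear_combination (-2 * c * (2 * c - 2) - 2 * s * (2 * s + 1)) * h₁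
      + (2 * s * (1 + s) + c * (2 * c - 2)) * r₃
      + (c * (2 * s + 1) - 2 * c * (1 + s)) * r₄)).resolve_left hD
  have e₃ : g₃ = 0 := (mul_eq_zero.mp (by
    linear_combination ((2 * s + 1) * (3 * s + 1) + 4 * c * (2 * c - 2)) * h₁
      + (-2 * (2 * c - 2) - (1 + s) * (3 * s + 1)) * r₃
      + (4 * c * (1 + s) - 2 * (2 * s + 1)) * r₄)).resolve_left hD
  subst e₀ e₂ e₃
  refine ⟨rfl, ?_, rfl, rfl, ?_⟩
  · linear_combination c * h₂ - s * h₅ - g₁ * h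
  · linear_combination -s * h₂ - c * h₅ - g₄ * h

lemma hasDerivAt_vec5 {f₀ f₁ f₂ f₃ f₄ : ℝ → ℝ} {d₀ d₁ d₂ d₃ d₄ t : ℝ}
    (h₀ : HasDerivAt f₀ d₀ t) (h₁ : HasDerivAt f₁ d₁ t) (h₂ : HasDerivAt f₂ d₂ t)
    (h₃ : HasDerivAt f₃ d₃ t) (h₄ : HasDerivAt f₄ d₄ t) :
    HasDerivAt (fun u => ![f₀ u, f₁ u, f₂ u, f₃ u, f₄ u]) ![d₀, d₁, d₂, d₃, d₄] t := by
  rw [hasDerivAt_pi]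
  intro i
  fin_cases i <;> assumption

section PartialDerivatives

variable (x y : ℝ)

lemma hasDerivAt_cos_two_mul : HasDerivAt (fun u => cos (2 * u)) (-(2 * sin (2 * x))) x := by
  simpa [mul_comm] using ((hasDerivAt_id x).const_mul 2).cos

lemma hasDerivAt_sin_two_mul : HasDerivAt (fun u => sin (2 * u)) (2 * cos (2 * x)) x := by
  simpa [mul_comm] using ((hasDerivAt_id x).const_mul 2).sin

lemma hasDerivAt_cos_two_mul_add :
    HasDerivAt (fun u => cos (2 * u + y)) (-(2 * sin (2 * x + y))) x := by
  simpa [mul_comm] using (((hasDerivAt_id x).const_mul 2).add_const y).cos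

lemma hasDerivAt_sin_two_mul_add :
    HasDerivAt (fun u => sin (2 * u + y)) (2 * cos (2 * x + y)) x := by
  simpa [mul_comm] using (((hasDerivAt_id x).const_mul 2).add_const y).sin

lemma hasDerivAt_cos_const_add (a : ℝ) : HasDerivAt (fun u => cos (a + u)) (-sin (a + y)) y := by
  simpa using ((hasDerivAt_id y).const_add a).cos

lemma hasDerivAt_sin_const_add (a : ℝ) : HasDerivAt (fun u => sin (a + u)) (cos (a + y)) y := by
  simpa using ((hasDerivAt_id y).const_add a).sin

lemma deriv_F₂_fst : deriv (fun u => F₂ u y) x =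
    ![-2 * sin x - (1 + sin y) * cos x, 2 * cos x - (1 + sin y) * sin x,
      -2 * sin (2 * x + y) - cos (2 * x), 2 * cos (2 * x + y) - sin (2 * x), 0] := by
  refine ((hasDerivAt_vec5
    (((hasDerivAt_cos x).const_mul 2).sub ((hasDerivAt_sin x).const_mul (1 + sin y)))
    (((hasDerivAt_sin x).const_mul 2).add ((hasDerivAt_cos x).const_mul (1 + sin y)))
    ((hasDerivAt_cos_two_mul_add x y).sub ((hasDerivAt_sin_two_mul x).const_mul (1 / 2)))
    ((hasDerivAt_sin_two_mul_add x y).add ((hasDerivAt_cos_two_mul x).const_mul (1 / 2)))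
    (hasDerivAt_const x (cos y))).deriv).trans ?_
  ext i
  fin_cases i <;> simp <;> ring

lemma deriv_F₂_snd : deriv (fun u => F₂ x u) y =
    ![-cos y * sin x, cos y * cos x, -sin (2 * x + y), cos (2 * x + y), -sin y] := by
  refine ((hasDerivAt_vec5
    ((((hasDerivAt_sin y).const_add 1).mul_const (sin x)).const_sub (2 * cos x))
    ((((hasDerivAt_sin y).const_add 1).mul_const (cos x)).const_add (2 * sin x))
    ((hasDerivAt_cos_const_add y (2 * x)).sub_const (1 / 2 * sin (2 * x)))
    ((hasDerivAt_sin_const_add y (2 * x)).add_const (1 / 2 * cos (2 * x)))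
    (hasDerivAt_cos y)).deriv).trans ?_
  ext i
  fin_cases i <;> simp

lemma deriv_F₂_fst_fst : deriv (fun v => deriv (fun u => F₂ u y) v) x =
    ![-2 * cos x + (1 + sin y) * sin x, -2 * sin x - (1 + sin y) * cos x,
      -4 * cos (2 * x + y) + 2 * sin (2 * x), -4 * sin (2 * x + y) - 2 * cos (2 * x), 0] := by
  simp only [deriv_F₂_fst]
  refine ((hasDerivAt_vec5
    (((hasDerivAt_sin x).const_mul (-2)).sub ((hasDerivAt_cos x).const_mul (1 + sin y)))
    (((hasDerivAt_cos x).const_mul 2).sub ((hasDerivAt_sin x).const_mul (1 + sin y)))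
    (((hasDerivAt_sin_two_mul_add x y).const_mul (-2)).sub (hasDerivAt_cos_two_mul x))
    (((hasDerivAt_cos_two_mul_add x y).const_mul 2).sub (hasDerivAt_sin_two_mul x))
    (hasDerivAt_const x 0)).deriv).trans ?_
  ext i
  fin_cases i <;> simp <;> ring

lemma deriv_F₂_fst_snd : deriv (fun v => deriv (fun u => F₂ u v) x) y =
    ![-cos y * cos x, -cos y * sin x, -2 * cos (2 * x + y), -2 * sin (2 * x + y), 0] := by
  simp only [deriv_F₂_fst]
  refine ((hasDerivAt_vec5
    ((((hasDerivAt_sin y).const_add 1).mul_const (cos x)).const_sub (-2 * sin x))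
    ((((hasDerivAt_sin y).const_add 1).mul_const (sin x)).const_sub (2 * cos x))
    (((hasDerivAt_sin_const_add y (2 * x)).const_mul (-2)).sub_const (cos (2 * x)))
    (((hasDerivAt_cos_const_add y (2 * x)).const_mul 2).sub_const (sin (2 * x)))
    (hasDerivAt_const y 0)).deriv).trans ?_
  ext i
  fin_cases i <;> simp

lemma deriv_F₂_snd_snd : deriv (fun v => deriv (fun u => F₂ x u) v) y =
    ![sin y * sin x, -sin y * cos x, -cos (2 * x + y), -sin (2 * x + y), -cos y] := by
  simp only [deriv_F₂_snd]
  refine ((hasDerivAt_vec5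
    ((hasDerivAt_cos y).neg.mul_const (sin x))
    ((hasDerivAt_cos y).mul_const (cos x))
    (hasDerivAt_sin_const_add y (2 * x)).neg
    (hasDerivAt_cos_const_add y (2 * x))
    (hasDerivAt_sin y).neg).deriv).trans ?_
  ext i
  fin_cases i <;> simp

end PartialDerivatives

/-- `F₂` is a free map: at every point the five vectors of first and
second partial derivatives are linearly independent in `ℝ⁵` (which is the critical
dimension `q₂ = 2·(2+3)/2 = 5`). Moreover `F₂` is smooth and `2π`-periodic in each
variable, hence induces a smooth free map of the 2-torus `T²` into `ℝ⁵`. -/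
theorem F₂_free :
    (∀ x y : ℝ, LinearIndependent ℝ
      ![deriv (fun x' => F₂ x' y) x,
        deriv (fun y' => F₂ x y') y,
        deriv (fun x' => deriv (fun x'' => F₂ x'' y) x') x,
        deriv (fun y' => deriv (fun x' => F₂ x' y') x) y,
        deriv (fun y' => deriv (fun y'' => F₂ x y'') y') y])
    ∧ ContDiff ℝ (⊤ : ℕ∞) (fun p : ℝ × ℝ => F₂ p.1 p.2)
    ∧ (∀ x y : ℝ, F₂ (x + 2 * π) y = F₂ x y ∧ F₂ x (y + 2 * π) = F₂ x y) := by
  refine ⟨fun x y => ?_, ?_, fun x y => ⟨?_, ?_⟩⟩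
  · rw [deriv_F₂_fst, deriv_F₂_snd, deriv_F₂_fst_fst, deriv_F₂_fst_snd, deriv_F₂_snd_snd,
      Fintype.linearIndependent_iff]
    intro g hg
    have k₀ := congrFun hg 0
    have k₁ := congrFun hg 1
    have k₂ := congrFun hg 2
    have k₃ := congrFun hg 3
    have k₄ := congrFun hg 4
    simp [Fin.sum_univ_five, cos_add, sin_add] at k₀ k₁ k₂ k₃ k₄
    have hx := cos_sq_add_sin_sq x
    have hxx := cos_sq_add_sin_sq (2 * x)
    obtain ⟨h₀, h₁, h₂, h₃, h₄⟩ := rotated_system_trivial (g₀ := g 0) (g₁ := g 1) (g₂ := g 2)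
      (g₃ := g 3) (g₄ := g 4) (cos_sq_add_sin_sq y)
      (by linear_combination cos x * k₀ + sin x * k₁
            - (-(1 + sin y) * g 0 - 2 * g 2 - cos y * g 3) * hx)
      (by linear_combination -sin x * k₀ + cos x * k₁
            - (2 * g 0 + cos y * g 1 - (1 + sin y) * g 2 - sin y * g 4) * hx)
      (by linear_combination cos (2 * x) * k₂ + sin (2 * x) * k₃
            - (-(2 * sin y + 1) * g 0 - sin y * g 1 - 4 * cos y * g 2 - 2 * cos y * g 3
                - cos y * g 4) * hxx)
      (by linear_combination -sin (2 * x) * k₂ + cos (2 * x) * k₃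
            - (2 * cos y * g 0 + cos y * g 1 - (4 * sin y + 2) * g 2 - 2 * sin y * g 3
                - sin y * g 4) * hxx)
      (by linear_combination k₄)
    intro i
    fin_cases i <;> assumption
  · rw [contDiff_pi]
    intro i
    fin_cases i <;> simp [F₂] <;> fun_prop
  · have h : 2 * (x + 2 * π) = 2 * x + 2 * π + 2 * π := by ring
    have h' : 2 * x + 2 * π + 2 * π + y = 2 * x + y + 2 * π + 2 * π := by ring
    simp [F₂, h, h']
  · simp [F₂, ← add_assoc]
end

section
/- Let A(x) denote the 2×2 rotation matrix ((cos x, −sin x),(sin x, cos x)). Let R₅(x₁,x₂,x₃,x₄) be the 20×20 block-diagonal matrix diag(A(x₁), A(x₂), A(x₃), A(x₁+x₂), A(x₁+x₃), A(x₂+x₃), A(x₃+x₄), A(x₄), A(x₁+x₄), A(x₂+x₄)). Write s = sin z, c = cos z, and let h(z) = −20 + 9s + 13c − 7 sin(2z) + 3 cos(2z). Let v₅ : ℝ → ℝ²⁰ be v₅(z) = (2, 1+s, c, 1/2+s, c, s, c, 2−c, −2s−5c, s, c, s, c, h(z), 10−7s, 2+4s−6c, −5+3s+5c, −9+15s+2c,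 −1+8s, −2+6c). Define F₅ : ℝ⁵ → ℝ²⁰ by F₅(x₁,x₂,x₃,x₄,z) = R₅(x₁,x₂,x₃,x₄)·v₅(z). Then F₅ is free: at every point of ℝ⁵ the twenty vectors of first and second partial derivatives of F₅ (the five first derivatives and the fifteen second derivatives ∂_{x_ix_j}F₅ for 1≤i≤j≤4, ∂_{x_iz}F₅ for i=1,…,4, and ∂_{zz}F₅) are linearly independent in ℝ²⁰. Since F₅ is 2π-periodic in each variable, it induces a smooth free map of the 5-torus T⁵ into ℝ²⁰, which is the critical dimension q₅ = 5·(5+3)/2 = 20. -/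
open Real Matrix

/-- The 20×20 block-diagonal rotation matrix `R₅(x₁,x₂,x₃,x₄) =
diag(A(x₁), A(x₂), A(x₃), A(x₁+x₂), A(x₁+x₃), A(x₂+x₃), A(x₃+x₄), A(x₄), A(x₁+x₄), A(x₂+x₄))`,
where `A(t)` is the 2×2 rotation matrix `((cos t, −sin t),(sin t, cos t))`. -/
noncomputable def R₅ (x₁ x₂ x₃ x₄ : ℝ) : Matrix (Fin 20) (Fin 20) ℝ :=
  !![cos (x₁), -sin (x₁), 0, 0, 0, 0, 0, 0, 0, 0, 0, 0, 0, 0, 0, 0, 0, 0, 0, 0;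
    sin (x₁), cos (x₁), 0, 0, 0, 0, 0, 0, 0, 0, 0, 0, 0, 0, 0, 0, 0, 0, 0, 0;
    0, 0, cos (x₂), -sin (x₂), 0, 0, 0, 0, 0, 0, 0, 0, 0, 0, 0, 0, 0, 0, 0, 0;
    0, 0, sin (x₂), cos (x₂), 0, 0, 0, 0, 0, 0, 0, 0, 0, 0, 0, 0, 0, 0, 0, 0;
    0, 0, 0, 0, cos (x₃), -sin (x₃), 0, 0, 0, 0, 0, 0, 0, 0, 0, 0, 0, 0, 0, 0;
    0, 0, 0, 0, sin (x₃), cos (x₃), 0, 0, 0, 0, 0, 0, 0, 0, 0, 0, 0, 0, 0, 0;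
    0, 0, 0, 0, 0, 0, cos (x₁ + x₂), -sin (x₁ + x₂), 0, 0, 0, 0, 0, 0, 0, 0, 0, 0, 0, 0;
    0, 0, 0, 0, 0, 0, sin (x₁ + x₂), cos (x₁ + x₂), 0, 0, 0, 0, 0, 0, 0, 0, 0, 0, 0, 0;
    0, 0, 0, 0, 0, 0, 0, 0, cos (x₁ + x₃), -sin (x₁ + x₃), 0, 0, 0, 0, 0, 0, 0, 0, 0, 0;
    0, 0, 0, 0, 0, 0, 0, 0, sin (x₁ + x₃), cos (x₁ + x₃), 0, 0, 0, 0, 0, 0, 0, 0, 0, 0;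
    0, 0, 0, 0, 0, 0, 0, 0, 0, 0, cos (x₂ + x₃), -sin (x₂ + x₃), 0, 0, 0, 0, 0, 0, 0, 0;
    0, 0, 0, 0, 0, 0, 0, 0, 0, 0, sin (x₂ + x₃), cos (x₂ + x₃), 0, 0, 0, 0, 0, 0, 0, 0;
    0, 0, 0, 0, 0, 0, 0, 0, 0, 0, 0, 0, cos (x₃ + x₄), -sin (x₃ + x₄), 0, 0, 0, 0, 0, 0;
    0, 0, 0, 0, 0, 0, 0, 0, 0, 0, 0, 0, sin (x₃ + x₄), cos (x₃ + x₄), 0, 0, 0, 0, 0, 0;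
    0, 0, 0, 0, 0, 0, 0, 0, 0, 0, 0, 0, 0, 0, cos (x₄), -sin (x₄), 0, 0, 0, 0;
    0, 0, 0, 0, 0, 0, 0, 0, 0, 0, 0, 0, 0, 0, sin (x₄), cos (x₄), 0, 0, 0, 0;
    0, 0, 0, 0, 0, 0, 0, 0, 0, 0, 0, 0, 0, 0, 0, 0, cos (x₁ + x₄), -sin (x₁ + x₄), 0, 0;
    0, 0, 0, 0, 0, 0, 0, 0, 0, 0, 0, 0, 0, 0, 0, 0, sin (x₁ + x₄), cos (x₁ + x₄), 0, 0;
    0, 0, 0, 0, 0, 0, 0, 0, 0, 0, 0, 0, 0, 0, 0, 0, 0, 0, cos (x₂ + x₄), -sin (x₂ + x₄);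
    0, 0, 0, 0, 0, 0, 0, 0, 0, 0, 0, 0, 0, 0, 0, 0, 0, 0, sin (x₂ + x₄), cos (x₂ + x₄)]

/-- `h(z) = −20 + 9 sin z + 13 cos z − 7 sin 2z + 3 cos 2z`. -/
noncomputable def h (z : ℝ) : ℝ :=
  -20 + 9 * sin z + 13 * cos z - 7 * sin (2 * z) + 3 * cos (2 * z)

/-- The loop `v₅ : ℝ → ℝ²⁰` (written with `s = sin z`, `c = cos z`). -/
noncomputable def v₅ (z : ℝ) : Fin 20 → ℝ :=
  ![2, 1 + sin z, cos z, 1 / 2 + sin z, cos z, sin z, cos z, 2 - cos z,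
    -2 * sin z - 5 * cos z, sin z, cos z, sin z, cos z, h z,
    10 - 7 * sin z, 2 + 4 * sin z - 6 * cos z, -5 + 3 * sin z + 5 * cos z,
    -9 + 15 * sin z + 2 * cos z, -1 + 8 * sin z, -2 + 6 * cos z]

/-- The map `F₅(x₁,x₂,x₃,x₄,z) = R₅(x₁,x₂,x₃,x₄)·v₅(z) : ℝ⁵ → ℝ²⁰`. -/
noncomputable def F₅ (x₁ x₂ x₃ x₄ z : ℝ) : Fin 20 → ℝ := R₅ x₁ x₂ x₃ x₄ *ᵥ v₅ z

/-- The value at `x` of the polynomial with coefficient list `l`, lowest degree first. -/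
def evalList : List ℤ → ℝ → ℝ
  | [], _ => 0
  | a :: l, x => a + x * evalList l x

/-- The coefficient list of the sum of two polynomials. -/
def addList : List ℤ → List ℤ → List ℤ
  | [], m => m
  | a :: l, [] => a :: l
  | a :: l, b :: m => (a + b) :: addList l m

/-- The coefficient list of the product of a polynomial with `a + b x`. -/
def mulLin (a b : ℤ) (l : List ℤ) : List ℤ :=
  addList (l.map (a * ·)) (0 :: l.map (b * ·))

/-- The coefficient list of `(c + d x) ^ n`. -/
def linPow (c d : ℤ) : ℕ → List ℤ
  | 0 => [1]
  | n + 1 => mulLin c d (linPow c d n)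

/-- The numerator of the polynomial `l` after the substitution `(a + b x) / (c + d x)`, over the
denominator `(c + d x) ^ l.length`. -/
def mobius (a b c d : ℤ) : List ℤ → List ℤ
  | [] => []
  | k :: l => addList ((linPow c d (l.length + 1)).map (k * ·)) (mulLin a b (mobius a b c d l))

/-- All coefficients are nonnegative, and the constant one is positive. -/
def PosCoeffs : List ℤ → Prop
  | [] => False
  | a :: l => 0 < a ∧ ∀ b ∈ l, 0 ≤ b

instance : DecidablePred PosCoeffs
  | [] => inferInstanceAs (Decidable False)
  | a :: l => inferInstanceAs (Decidable (0 < a ∧ ∀ b ∈ l, 0 ≤ b))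

theorem evalList_addList (l m : List ℤ) (x : ℝ) :
    evalList (addList l m) x = evalList l x + evalList m x := by
  induction l generalizing m with
  | nil => simp [addList, evalList]
  | cons a l ih =>
    cases m with
    | nil => simp [addList, evalList]
    | cons b m =>
      simp only [addList, evalList, ih, Int.cast_add]
      ring

theorem evalList_map_mul (a : ℤ) (l : List ℤ) (x : ℝ) :
    evalList (l.map (a * ·)) x = a * evalList l x := by
  induction l with
  | nil => simp [evalList]
  | cons b l ih =>
    simp only [List.map_cons, evalList, ih, Int.cast_mul]
    ring

theorem evalList_mulLin (a b : ℤ) (l : List ℤ) (x : ℝ) :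
    evalList (mulLin a b l) x = (a + b * x) * evalList l x := by
  simp only [mulLin, evalList_addList, evalList, evalList_map_mul, Int.cast_zero]
  ring

theorem evalList_linPow (c d : ℤ) (n : ℕ) (x : ℝ) :
    evalList (linPow c d n) x = (c + d * x) ^ n := by
  induction n with
  | zero => simp [linPow, evalList]
  | succ n ih => rw [linPow, evalList_mulLin, ih, pow_succ']

theorem evalList_mobius {a b c d : ℤ} {t x : ℝ} (h : a + b * x = t * (c + d * x)) (l : List ℤ) :
    evalList (mobius a b c d l) x = (c + d * x) ^ l.length * evalList l t := by
  induction l with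
  | nil => simp [mobius, evalList]
  | cons k l ih =>
    simp only [mobius, evalList_addList, evalList_map_mul, evalList_linPow, evalList_mulLin, ih,
      evalList, List.length_cons, h]
    ring

theorem evalList_nonneg {l : List ℤ} (hl : ∀ b ∈ l, 0 ≤ b) {x : ℝ} (hx : 0 ≤ x) :
    0 ≤ evalList l x := by
  induction l with
  | nil => simp [evalList]
  | cons a l ih =>
    have ha : (0 : ℝ) ≤ a := by exact_mod_cast hl a (by simp)
    exact add_nonneg ha (mul_nonneg hx (ih fun b hb => hl b (by simp [hb])))

theorem PosCoeffs.evalList_pos {l : List ℤ} (hl : PosCoeffs l) {x : ℝ} (hx : 0 ≤ x) :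
    0 < evalList l x := by
  cases l with
  | nil => exact hl.elim
  | cons a l =>
    have ha : (0 : ℝ) < a := by exact_mod_cast hl.1
    exact add_pos_of_pos_of_nonneg ha (mul_nonneg hx (evalList_nonneg hl.2 hx))

theorem evalList_pos_of_mobius {a b c d : ℤ} {l : List ℤ} (hl : PosCoeffs (mobius a b c d l))
    {t x : ℝ} (hx : 0 ≤ x) (hcd : 0 < c + d * x) (h : a + b * x = t * (c + d * x)) :
    0 < evalList l t := by
  have := hl.evalList_pos hx
  rw [evalList_mobius h] at this
  exact pos_of_mul_pos_right this (by positivity)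

theorem evalList_pos_of_mem_Ico {a b d : ℤ} {l : List ℤ} (hl : PosCoeffs (mobius a b d d l))
    (hd : 0 < d) {t : ℝ} (ha : a ≤ d * t) (hb : d * t < b) : 0 < evalList l t := by
  have hd' : (0 : ℝ) < d := by exact_mod_cast hd
  have hb' : 0 < b - d * t := sub_pos.2 hb
  have hx : 0 ≤ (d * t - a) / (b - d * t) := div_nonneg (sub_nonneg.2 ha) hb'.le
  refine evalList_pos_of_mobius hl hx (by positivity) ?_
  field_simp
  ring

/-- Up to a nonvanishing factor, the coefficients of the determinant of the freeness system of `F₅`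
as a polynomial in `t = tan (z / 2)`. -/
def detCoeffs : List ℤ :=
  [31323383, 556778231, 825226562, -21815976883, 32579002569, -220811972984, 1510468701704,
   -3186261979934, 3350543510787, 1292472102877, -11501063683086, 15577263136307,
   -14517622927963, 3268374586002, 21472401285768, -25348019324964, 25482315716693,
   -21861751542991, 5595350131014, 2630615579619, -120786989829, -2477734829532, 2292426754728,
   -481559278174, -144872546831, 122061694107, -87997190138, -106196846787, 31205272663,
   19653577250, 3874978376]

theorem evalList_detCoeffs_pos (t : ℝ) : 0 < evalList detCoeffs t := by
  rcases le_or_gt t (-1) with h₁ | h₁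
  · exact evalList_pos_of_mobius (a := -1) (b := -1) (c := 1) (d := 0) (x := -1 - t)
      (by decide +kernel) (by linarith) (by norm_num) (by push_cast; ring)
  rcases lt_or_ge t (-1 / 8) with h₂ | h₂
  · exact evalList_pos_of_mem_Ico (a := -8) (b := -1) (d := 8) (by decide +kernel) (by norm_num)
      (by push_cast; linarith) (by push_cast; linarith)
  rcases lt_or_ge t (1 / 4) with h₃ | h₃
  · exact evalList_pos_of_mem_Ico (a := -1) (b := 2) (d := 8) (by decide +kernel) (by norm_num)
      (by push_cast; linarith) (by push_cast; linarith)
  rcases lt_or_ge t (3 / 4) with h₄ | h₄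
  · exact evalList_pos_of_mem_Ico (a := 1) (b := 3) (d := 4) (by decide +kernel) (by norm_num)
      (by push_cast; linarith) (by push_cast; linarith)
  rcases lt_or_ge t (3 / 2) with h₅ | h₅
  · exact evalList_pos_of_mem_Ico (a := 3) (b := 6) (d := 4) (by decide +kernel) (by norm_num)
      (by push_cast; linarith) (by push_cast; linarith)
  · exact evalList_pos_of_mobius (a := 3) (b := 1) (c := 2) (d := 0) (x := 2 * t - 3)
      (by decide +kernel) (by linarith) (by norm_num) (by push_cast; ring)

/-- The phases of the ten rotation blocks of `R₅`. -/
def phase (x₁ x₂ x₃ x₄ : ℝ) : Fin 10 → ℝ :=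
  ![x₁, x₂, x₃, x₁ + x₂, x₁ + x₃, x₂ + x₃, x₃ + x₄, x₄, x₁ + x₄, x₂ + x₄]

/-- Rotate the `k`-th pair of coordinates of `u` by the angle `θ k`. -/
noncomputable def rotBlocks (θ : Fin 10 → ℝ) (u : Fin 20 → ℝ) : Fin 20 → ℝ :=
  ![cos (θ 0) * u 0 - sin (θ 0) * u 1, sin (θ 0) * u 0 + cos (θ 0) * u 1,
    cos (θ 1) * u 2 - sin (θ 1) * u 3, sin (θ 1) * u 2 + cos (θ 1) * u 3,
    cos (θ 2) * u 4 - sin (θ 2) * u 5, sin (θ 2) * u 4 + cos (θ 2) * u 5,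
    cos (θ 3) * u 6 - sin (θ 3) * u 7, sin (θ 3) * u 6 + cos (θ 3) * u 7,
    cos (θ 4) * u 8 - sin (θ 4) * u 9, sin (θ 4) * u 8 + cos (θ 4) * u 9,
    cos (θ 5) * u 10 - sin (θ 5) * u 11, sin (θ 5) * u 10 + cos (θ 5) * u 11,
    cos (θ 6) * u 12 - sin (θ 6) * u 13, sin (θ 6) * u 12 + cos (θ 6) * u 13,
    cos (θ 7) * u 14 - sin (θ 7) * u 15, sin (θ 7) * u 14 + cos (θ 7) * u 15,
    cos (θ 8) * u 16 - sin (θ 8) * u 17, sin (θ 8) * u 16 + cos (θ 8) * u 17,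
    cos (θ 9) * u 18 - sin (θ 9) * u 19, sin (θ 9) * u 18 + cos (θ 9) * u 19]

/-- Turn the `k`-th pair of coordinates of `u` by a right angle and scale it by `a k`. -/
def quarterTurn (a : Fin 10 → ℝ) (u : Fin 20 → ℝ) : Fin 20 → ℝ :=
  ![-(a 0 * u 1), a 0 * u 0, -(a 1 * u 3), a 1 * u 2, -(a 2 * u 5), a 2 * u 4,
    -(a 3 * u 7), a 3 * u 6, -(a 4 * u 9), a 4 * u 8, -(a 5 * u 11), a 5 * u 10,
    -(a 6 * u 13), a 6 * u 12, -(a 7 * u 15), a 7 * u 14, -(a 8 * u 17), a 8 * u 16,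
    -(a 9 * u 19), a 9 * u 18]

set_option maxHeartbeats 1000000 in
theorem R₅_mulVec (x₁ x₂ x₃ x₄ : ℝ) (u : Fin 20 → ℝ) :
    R₅ x₁ x₂ x₃ x₄ *ᵥ u = rotBlocks (phase x₁ x₂ x₃ x₄) u := by
  simp only [R₅, Matrix.cons_mulVec, Matrix.empty_mulVec, rotBlocks, phase]
  ext i
  fin_cases i <;> simp [dotProduct, Fin.sum_univ_succ, sub_eq_add_neg]

theorem F₅_eq (x₁ x₂ x₃ x₄ z : ℝ) :
    F₅ x₁ x₂ x₃ x₄ z = rotBlocks (phase x₁ x₂ x₃ x₄) (v₅ z) :=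
  R₅_mulVec ..

theorem rotBlocks_add (θ : Fin 10 → ℝ) (u w : Fin 20 → ℝ) :
    rotBlocks θ (u + w) = rotBlocks θ u + rotBlocks θ w := by
  ext i
  fin_cases i <;> simp [rotBlocks] <;> ring

theorem rotBlocks_smul (θ : Fin 10 → ℝ) (r : ℝ) (u : Fin 20 → ℝ) :
    rotBlocks θ (r • u) = r • rotBlocks θ u := by
  ext i
  fin_cases i <;> simp [rotBlocks] <;> ring

/-- `rotBlocks θ` as a linear map. -/
noncomputable def rotBlocksₗ (θ : Fin 10 → ℝ) : (Fin 20 → ℝ) →ₗ[ℝ] (Fin 20 → ℝ) where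
  toFun := rotBlocks θ
  map_add' := rotBlocks_add θ
  map_smul' := rotBlocks_smul θ

theorem rotBlocks_neg_self (θ : Fin 10 → ℝ) (u : Fin 20 → ℝ) :
    rotBlocks (-θ) (rotBlocks θ u) = u := by
  ext i
  fin_cases i <;> simp [rotBlocks] <;> ring_nf <;> simp [Real.sin_sq] <;> ring

theorem rotBlocksₗ_ker (θ : Fin 10 → ℝ) : LinearMap.ker (rotBlocksₗ θ) = ⊥ :=
  LinearMap.ker_eq_bot.2 (Function.LeftInverse.injective (rotBlocks_neg_self θ))

theorem quarterTurn_add (a : Fin 10 → ℝ) (u w : Fin 20 → ℝ) :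
    quarterTurn a (u + w) = quarterTurn a u + quarterTurn a w := by
  ext i
  fin_cases i <;> simp [quarterTurn] <;> ring

theorem quarterTurn_smul (a : Fin 10 → ℝ) (r : ℝ) (u : Fin 20 → ℝ) :
    quarterTurn a (r • u) = r • quarterTurn a u := by
  ext i
  fin_cases i <;> simp [quarterTurn] <;> ring

/-- `quarterTurn a` as a linear map. -/
def quarterTurnₗ (a : Fin 10 → ℝ) : (Fin 20 → ℝ) →ₗ[ℝ] (Fin 20 → ℝ) where
  toFun := quarterTurn a
  map_add' := quarterTurn_add a
  map_smul' := quarterTurn_smul a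

theorem hasDerivAt_rotBlocks_phase {θ : ℝ → Fin 10 → ℝ} {a : Fin 10 → ℝ} {t : ℝ}
    (hθ : HasDerivAt θ a t) (u : Fin 20 → ℝ) :
    HasDerivAt (fun t => rotBlocks (θ t) u) (rotBlocks (θ t) (quarterTurn a u)) t := by
  have hc (k : Fin 10) : HasDerivAt (fun t => cos (θ t k)) (-sin (θ t k) * a k) t :=
    (hasDerivAt_pi.1 hθ k).cos
  have hs (k : Fin 10) : HasDerivAt (fun t => sin (θ t k)) (cos (θ t k) * a k) t :=
    (hasDerivAt_pi.1 hθ k).sin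
  have hx (k : Fin 10) (p q : ℝ) : HasDerivAt (fun t => cos (θ t k) * p - sin (θ t k) * q)
      (cos (θ t k) * -(a k * q) - sin (θ t k) * (a k * p)) t :=
    (((hc k).mul_const p).sub ((hs k).mul_const q)).congr_deriv (by ring)
  have hy (k : Fin 10) (p q : ℝ) : HasDerivAt (fun t => sin (θ t k) * p + cos (θ t k) * q)
      (sin (θ t k) * -(a k * q) + cos (θ t k) * (a k * p)) t :=
    (((hs k).mul_const p).add ((hc k).mul_const q)).congr_deriv (by ring)
  refine hasDerivAt_pi.2 fun i => ?_
  fin_cases i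
  exacts [hx 0 _ _, hy 0 _ _, hx 1 _ _, hy 1 _ _, hx 2 _ _, hy 2 _ _, hx 3 _ _, hy 3 _ _,
    hx 4 _ _, hy 4 _ _, hx 5 _ _, hy 5 _ _, hx 6 _ _, hy 6 _ _, hx 7 _ _, hy 7 _ _,
    hx 8 _ _, hy 8 _ _, hx 9 _ _, hy 9 _ _]

theorem hasDerivAt_rotBlocks {u : ℝ → Fin 20 → ℝ} {u' : Fin 20 → ℝ} {t : ℝ}
    (hu : HasDerivAt u u' t) (θ : Fin 10 → ℝ) :
    HasDerivAt (fun t => rotBlocks θ (u t)) (rotBlocks θ u') t :=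
  (rotBlocksₗ θ).toContinuousLinearMap.hasFDerivAt.comp_hasDerivAt t hu

theorem hasDerivAt_quarterTurn {u : ℝ → Fin 20 → ℝ} {u' : Fin 20 → ℝ} {t : ℝ}
    (hu : HasDerivAt u u' t) (a : Fin 10 → ℝ) :
    HasDerivAt (fun t => quarterTurn a (u t)) (quarterTurn a u') t :=
  (quarterTurnₗ a).toContinuousLinearMap.hasFDerivAt.comp_hasDerivAt t hu

/-- The coefficients of `x₁` in the phases of the blocks. -/
def freq₁ : Fin 10 → ℝ := ![1, 0, 0, 1, 1, 0, 0, 0, 1, 0]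

/-- The coefficients of `x₂` in the phases of the blocks. -/
def freq₂ : Fin 10 → ℝ := ![0, 1, 0, 1, 0, 1, 0, 0, 0, 1]

/-- The coefficients of `x₃` in the phases of the blocks. -/
def freq₃ : Fin 10 → ℝ := ![0, 0, 1, 0, 1, 1, 1, 0, 0, 0]

/-- The coefficients of `x₄` in the phases of the blocks. -/
def freq₄ : Fin 10 → ℝ := ![0, 0, 0, 0, 0, 0, 1, 1, 1, 1]

theorem hasDerivAt_phase₁ (x₁ x₂ x₃ x₄ : ℝ) :
    HasDerivAt (fun t => phase t x₂ x₃ x₄) freq₁ x₁ := by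
  refine hasDerivAt_pi.2 fun i => ?_
  fin_cases i <;> simp [phase, freq₁, hasDerivAt_id', hasDerivAt_const]

theorem hasDerivAt_phase₂ (x₁ x₂ x₃ x₄ : ℝ) :
    HasDerivAt (fun t => phase x₁ t x₃ x₄) freq₂ x₂ := by
  refine hasDerivAt_pi.2 fun i => ?_
  fin_cases i <;> simp [phase, freq₂, hasDerivAt_id', hasDerivAt_const]
  exact (hasDerivAt_id' _).const_add _

theorem hasDerivAt_phase₃ (x₁ x₂ x₃ x₄ : ℝ) :
    HasDerivAt (fun t => phase x₁ x₂ t x₄) freq₃ x₃ := by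
  refine hasDerivAt_pi.2 fun i => ?_
  fin_cases i <;> simp [phase, freq₃, hasDerivAt_id', hasDerivAt_const] <;>
    exact (hasDerivAt_id' _).const_add _

theorem hasDerivAt_phase₄ (x₁ x₂ x₃ x₄ : ℝ) :
    HasDerivAt (fun t => phase x₁ x₂ x₃ t) freq₄ x₄ := by
  refine hasDerivAt_pi.2 fun i => ?_
  fin_cases i <;> simp [phase, freq₄, hasDerivAt_id', hasDerivAt_const] <;>
    exact (hasDerivAt_id' _).const_add _

/-- The derivative of `h`. -/
noncomputable def h' (z : ℝ) : ℝ :=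
  9 * cos z - 13 * sin z - 14 * cos (2 * z) - 6 * sin (2 * z)

/-- The second derivative of `h`. -/
noncomputable def h'' (z : ℝ) : ℝ :=
  -9 * sin z - 13 * cos z + 28 * sin (2 * z) - 12 * cos (2 * z)

/-- The derivative of `v₅`. -/
noncomputable def v₅' (z : ℝ) : Fin 20 → ℝ :=
  ![0, cos z, -sin z, cos z, -sin z, cos z, -sin z, sin z, -2 * cos z + 5 * sin z, cos z,
    -sin z, cos z, -sin z, h' z, -7 * cos z, 4 * cos z + 6 * sin z, 3 * cos z - 5 * sin z,
    15 * cos z - 2 * sin z, 8 * cos z, -6 * sin z]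

/-- The second derivative of `v₅`. -/
noncomputable def v₅'' (z : ℝ) : Fin 20 → ℝ :=
  ![0, -sin z, -cos z, -sin z, -cos z, -sin z, -cos z, cos z, 2 * sin z + 5 * cos z, -sin z,
    -cos z, -sin z, -cos z, h'' z, 7 * sin z, -4 * sin z + 6 * cos z, -3 * sin z - 5 * cos z,
    -15 * sin z - 2 * cos z, -8 * sin z, -6 * cos z]

theorem hasDerivAt_trig (a b c d e z : ℝ) :
    HasDerivAt (fun z => a + b * sin z + c * cos z + d * sin (2 * z) + e * cos (2 * z))
      (b * cos z - c * sin z + 2 * d * cos (2 * z) - 2 * e * sin (2 * z)) z := by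
  have h₂ : HasDerivAt (fun z : ℝ => 2 * z) 2 z := by
    simpa using (hasDerivAt_id z).const_mul 2
  exact (((((hasDerivAt_sin z).const_mul b).const_add a).add
    ((hasDerivAt_cos z).const_mul c)).add (h₂.sin.const_mul d)).add (h₂.cos.const_mul e)
    |>.congr_deriv (by ring)

theorem hasDerivAt_of_trig {f : ℝ → ℝ} {f' z : ℝ} (a b c d e : ℝ)
    (hf : ∀ z, f z = a + b * sin z + c * cos z + d * sin (2 * z) + e * cos (2 * z))
    (hf' : f' = b * cos z - c * sin z + 2 * d * cos (2 * z) - 2 * e * sin (2 * z)) :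
    HasDerivAt f f' z := by
  rw [funext hf, hf']
  exact hasDerivAt_trig a b c d e z

theorem hasDerivAt_v₅ (z : ℝ) : HasDerivAt v₅ (v₅' z) z := by
  refine hasDerivAt_pi.2 fun i => ?_
  fin_cases i
  · exact hasDerivAt_of_trig 2 0 0 0 0 (fun z => by simp [v₅]) (by simp [v₅'])
  · exact hasDerivAt_of_trig 1 1 0 0 0 (fun z => by simp [v₅]) (by simp [v₅'])
  · exact hasDerivAt_of_trig 0 0 1 0 0 (fun z => by simp [v₅]) (by simp [v₅'])
  · exact hasDerivAt_of_trig (1 / 2) 1 0 0 0 (fun z => by simp [v₅]) (by simp [v₅'])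
  · exact hasDerivAt_of_trig 0 0 1 0 0 (fun z => by simp [v₅]) (by simp [v₅'])
  · exact hasDerivAt_of_trig 0 1 0 0 0 (fun z => by simp [v₅]) (by simp [v₅'])
  · exact hasDerivAt_of_trig 0 0 1 0 0 (fun z => by simp [v₅]) (by simp [v₅'])
  · exact hasDerivAt_of_trig 2 0 (-1) 0 0 (fun z => by simp [v₅]; ring) (by simp [v₅'])
  · exact hasDerivAt_of_trig 0 (-2) (-5) 0 0 (fun z => by simp [v₅]; ring) (by simp [v₅'])
  · exact hasDerivAt_of_trig 0 1 0 0 0 (fun z => by simp [v₅]) (by simp [v₅'])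
  · exact hasDerivAt_of_trig 0 0 1 0 0 (fun z => by simp [v₅]) (by simp [v₅'])
  · exact hasDerivAt_of_trig 0 1 0 0 0 (fun z => by simp [v₅]) (by simp [v₅'])
  · exact hasDerivAt_of_trig 0 0 1 0 0 (fun z => by simp [v₅]) (by simp [v₅'])
  · exact hasDerivAt_of_trig (-20) 9 13 (-7) 3 (fun z => by simp [v₅, h]; ring)
      (by simp [v₅', h']; ring)
  · exact hasDerivAt_of_trig 10 (-7) 0 0 0 (fun z => by simp [v₅]; ring) (by simp [v₅'])
  · exact hasDerivAt_of_trig 2 4 (-6) 0 0 (fun z => by simp [v₅]; ring) (by simp [v₅'])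
  · exact hasDerivAt_of_trig (-5) 3 5 0 0 (fun z => by simp [v₅]) (by simp [v₅'])
  · exact hasDerivAt_of_trig (-9) 15 2 0 0 (fun z => by simp [v₅]) (by simp [v₅'])
  · exact hasDerivAt_of_trig (-1) 8 0 0 0 (fun z => by simp [v₅]) (by simp [v₅'])
  · exact hasDerivAt_of_trig (-2) 0 6 0 0 (fun z => by simp [v₅]) (by simp [v₅'])

theorem hasDerivAt_v₅' (z : ℝ) : HasDerivAt v₅' (v₅'' z) z := by
  refine hasDerivAt_pi.2 fun i => ?_
  fin_cases i
  · exact hasDerivAt_of_trig 0 0 0 0 0 (fun z => by simp [v₅']) (by simp [v₅''])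
  · exact hasDerivAt_of_trig 0 0 1 0 0 (fun z => by simp [v₅']) (by simp [v₅''])
  · exact hasDerivAt_of_trig 0 (-1) 0 0 0 (fun z => by simp [v₅']) (by simp [v₅''])
  · exact hasDerivAt_of_trig 0 0 1 0 0 (fun z => by simp [v₅']) (by simp [v₅''])
  · exact hasDerivAt_of_trig 0 (-1) 0 0 0 (fun z => by simp [v₅']) (by simp [v₅''])
  · exact hasDerivAt_of_trig 0 0 1 0 0 (fun z => by simp [v₅']) (by simp [v₅''])
  · exact hasDerivAt_of_trig 0 (-1) 0 0 0 (fun z => by simp [v₅']) (by simp [v₅''])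
  · exact hasDerivAt_of_trig 0 1 0 0 0 (fun z => by simp [v₅']) (by simp [v₅''])
  · exact hasDerivAt_of_trig 0 5 (-2) 0 0 (fun z => by simp [v₅']; ring) (by simp [v₅'']; ring)
  · exact hasDerivAt_of_trig 0 0 1 0 0 (fun z => by simp [v₅']) (by simp [v₅''])
  · exact hasDerivAt_of_trig 0 (-1) 0 0 0 (fun z => by simp [v₅']) (by simp [v₅''])
  · exact hasDerivAt_of_trig 0 0 1 0 0 (fun z => by simp [v₅']) (by simp [v₅''])
  · exact hasDerivAt_of_trig 0 (-1) 0 0 0 (fun z => by simp [v₅']) (by simp [v₅''])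
  · exact hasDerivAt_of_trig 0 (-13) 9 (-6) (-14) (fun z => by simp [v₅', h']; ring)
      (by simp [v₅'', h'']; ring)
  · exact hasDerivAt_of_trig 0 0 (-7) 0 0 (fun z => by simp [v₅']) (by simp [v₅''])
  · exact hasDerivAt_of_trig 0 6 4 0 0 (fun z => by simp [v₅']; ring) (by simp [v₅'']; ring)
  · exact hasDerivAt_of_trig 0 (-5) 3 0 0 (fun z => by simp [v₅']; ring) (by simp [v₅'']; ring)
  · exact hasDerivAt_of_trig 0 (-2) 15 0 0 (fun z => by simp [v₅']; ring) (by simp [v₅'']; ring)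
  · exact hasDerivAt_of_trig 0 0 8 0 0 (fun z => by simp [v₅']) (by simp [v₅''])
  · exact hasDerivAt_of_trig 0 (-6) 0 0 0 (fun z => by simp [v₅']) (by simp [v₅''])

theorem deriv_rotBlocks_phase₁ (x₁ x₂ x₃ x₄ : ℝ) (u : Fin 20 → ℝ) :
    deriv (fun t => rotBlocks (phase t x₂ x₃ x₄) u) x₁ =
      rotBlocks (phase x₁ x₂ x₃ x₄) (quarterTurn freq₁ u) :=
  (hasDerivAt_rotBlocks_phase (hasDerivAt_phase₁ ..) u).deriv

theorem deriv_rotBlocks_phase₂ (x₁ x₂ x₃ x₄ : ℝ) (u : Fin 20 → ℝ) :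
    deriv (fun t => rotBlocks (phase x₁ t x₃ x₄) u) x₂ =
      rotBlocks (phase x₁ x₂ x₃ x₄) (quarterTurn freq₂ u) :=
  (hasDerivAt_rotBlocks_phase (hasDerivAt_phase₂ ..) u).deriv

theorem deriv_rotBlocks_phase₃ (x₁ x₂ x₃ x₄ : ℝ) (u : Fin 20 → ℝ) :
    deriv (fun t => rotBlocks (phase x₁ x₂ t x₄) u) x₃ =
      rotBlocks (phase x₁ x₂ x₃ x₄) (quarterTurn freq₃ u) :=
  (hasDerivAt_rotBlocks_phase (hasDerivAt_phase₃ ..) u).deriv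

theorem deriv_rotBlocks_phase₄ (x₁ x₂ x₃ x₄ : ℝ) (u : Fin 20 → ℝ) :
    deriv (fun t => rotBlocks (phase x₁ x₂ x₃ t) u) x₄ =
      rotBlocks (phase x₁ x₂ x₃ x₄) (quarterTurn freq₄ u) :=
  (hasDerivAt_rotBlocks_phase (hasDerivAt_phase₄ ..) u).deriv

theorem deriv_rotBlocks_v₅ (θ : Fin 10 → ℝ) (z : ℝ) :
    deriv (fun t => rotBlocks θ (v₅ t)) z = rotBlocks θ (v₅' z) :=
  (hasDerivAt_rotBlocks (hasDerivAt_v₅ z) θ).deriv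

theorem deriv_rotBlocks_v₅' (θ : Fin 10 → ℝ) (z : ℝ) :
    deriv (fun t => rotBlocks θ (v₅' t)) z = rotBlocks θ (v₅'' z) :=
  (hasDerivAt_rotBlocks (hasDerivAt_v₅' z) θ).deriv

theorem deriv_rotBlocks_quarterTurn_v₅ (θ a : Fin 10 → ℝ) (z : ℝ) :
    deriv (fun t => rotBlocks θ (quarterTurn a (v₅ t))) z =
      rotBlocks θ (quarterTurn a (v₅' z)) :=
  (hasDerivAt_rotBlocks (hasDerivAt_quarterTurn (hasDerivAt_v₅ z) a) θ).deriv

theorem contDiff_F₅ : ContDiff ℝ (⊤ : ℕ∞)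
    (fun p : ℝ × ℝ × ℝ × ℝ × ℝ => F₅ p.1 p.2.1 p.2.2.1 p.2.2.2.1 p.2.2.2.2) := by
  simp only [F₅_eq]
  refine contDiff_pi.2 fun i => ?_
  fin_cases i <;> simp [rotBlocks, phase, v₅, h] <;> fun_prop

theorem F₅_periodic (x₁ x₂ x₃ x₄ z : ℝ) :
    F₅ (x₁ + 2 * π) x₂ x₃ x₄ z = F₅ x₁ x₂ x₃ x₄ z ∧
    F₅ x₁ (x₂ + 2 * π) x₃ x₄ z = F₅ x₁ x₂ x₃ x₄ z ∧
    F₅ x₁ x₂ (x₃ + 2 * π) x₄ z = F₅ x₁ x₂ x₃ x₄ z ∧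
    F₅ x₁ x₂ x₃ (x₄ + 2 * π) z = F₅ x₁ x₂ x₃ x₄ z ∧
    F₅ x₁ x₂ x₃ x₄ (z + 2 * π) = F₅ x₁ x₂ x₃ x₄ z := by
  have hR (a b : ℝ) : a + 2 * π + b = a + b + 2 * π := by ring
  have hL (a b : ℝ) : a + (b + 2 * π) = a + b + 2 * π := by ring
  have hz : 2 * (z + 2 * π) = 2 * z + 2 * π + 2 * π := by ring
  refine ⟨?_, ?_, ?_, ?_, ?_⟩ <;> simp only [F₅_eq]
  · simp [rotBlocks, phase, hR]
  · simp [rotBlocks, phase, hR, hL]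
  · simp [rotBlocks, phase, hR, hL]
  · simp [rotBlocks, phase, hL]
  · simp [v₅, h, hz]

/-- The determinant of a sparse `5 × 5` matrix, see `sparseDet_eq_det`. -/
def sparseDet (a₁ a₂ a₃ b₁ b₂ b₃ b₄ c₁ c₂ c₄ c₅ d₁ d₂ d₃ d₅ e₁ e₂ e₅ : ℝ) : ℝ :=
  b₄ * (d₃ * (e₅ * (a₁ * c₂ - a₂ * c₁) - c₅ * (a₁ * e₂ - a₂ * e₁)) +
      a₃ * (c₁ * (d₂ * e₅ - d₅ * e₂) - c₂ * (d₁ * e₅ - d₅ * e₁) + c₅ * (d₁ * e₂ - d₂ * e₁))) +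
    c₄ * (d₅ * (a₃ * (b₁ * e₂ - b₂ * e₁) - b₃ * (a₁ * e₂ - a₂ * e₁)) -
      e₅ * (a₁ * (b₂ * d₃ - b₃ * d₂) - a₂ * (b₁ * d₃ - b₃ * d₁) + a₃ * (b₁ * d₂ - b₂ * d₁)))

theorem sparseDet_eq_det (a₁ a₂ a₃ b₁ b₂ b₃ b₄ c₁ c₂ c₄ c₅ d₁ d₂ d₃ d₅ e₁ e₂ e₅ : ℝ) :
    sparseDet a₁ a₂ a₃ b₁ b₂ b₃ b₄ c₁ c₂ c₄ c₅ d₁ d₂ d₃ d₅ e₁ e₂ e₅ =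
      Matrix.det !![a₁, a₂, a₃, 0, 0; b₁, b₂, b₃, b₄, 0; c₁, c₂, 0, c₄, c₅;
        d₁, d₂, d₃, 0, d₅; e₁, e₂, 0, 0, e₅] := by
  simp [sparseDet, Matrix.det_succ_row_zero, Fin.sum_univ_succ, Fin.succAbove]
  ring

theorem eq_zero_of_sparseDet_ne_zero
    {a₁ a₂ a₃ b₁ b₂ b₃ b₄ c₁ c₂ c₄ c₅ d₁ d₂ d₃ d₅ e₁ e₂ e₅ k β m₁ m₃ m₄ : ℝ}
    (hdet : sparseDet a₁ a₂ a₃ b₁ b₂ b₃ b₄ c₁ c₂ c₄ c₅ d₁ d₂ d₃ d₅ e₁ e₂ e₅ ≠ 0)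
    (ha : a₁ * k + a₂ * β + a₃ * m₁ = 0) (hb : b₁ * k + b₂ * β + b₃ * m₁ + b₄ * m₃ = 0)
    (hc : c₁ * k + c₂ * β + c₄ * m₃ + c₅ * m₄ = 0)
    (hd : d₁ * k + d₂ * β + d₃ * m₁ + d₅ * m₄ = 0) (he : e₁ * k + e₂ * β + e₅ * m₄ = 0) :
    k = 0 ∧ β = 0 ∧ m₁ = 0 ∧ m₃ = 0 ∧ m₄ = 0 := by
  rw [sparseDet_eq_det] at hdet
  have hv := Matrix.eq_zero_of_mulVec_eq_zero hdet (v := ![k, β, m₁, m₃, m₄]) (by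
    ext i
    fin_cases i <;> simp [Matrix.mulVec, dotProduct, Fin.sum_univ_succ]
    · linear_combination ha
    · linear_combination hb
    · linear_combination hc
    · linear_combination hd
    · linear_combination he)
  exact ⟨congr_fun hv 0, congr_fun hv 1, congr_fun hv 2, congr_fun hv 3, congr_fun hv 4⟩

/-- Elimination of `l₁` and `l₄` from the normal equations. -/
theorem eq_zero_of_normal_equations
    {n₁ i₁ r₁ j₁ n₄ i₄ r₄ j₄ n₅ i₅ r₅ n₇ i₇ r₇ j₇ n₈ i₈ r₈ j₈ n₉ i₉ r₉ j₉ n₁₀ i₁₀ r₁₀ j₁₀ x y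
      l₁ l₄ k β m₁ m₃ m₄ : ℝ}
    (hdet : sparseDet (n₁ * (y * r₄ - x * i₄) + n₄ * x * i₁) (n₁ * (j₄ - r₄) - n₄ * j₁)
      (n₁ * r₄ - n₄ * r₁) (n₁ * x * (n₅ - i₅) + n₅ * x * i₁) (-(n₅ * j₁)) (n₁ * r₅ - n₅ * r₁)
      (n₁ * r₅) (n₈ * x * (n₇ - i₇) + n₇ * x * i₈) (n₈ * j₇ - n₇ * j₈) (n₈ * r₇)
      (n₈ * r₇ - n₇ * r₈) (n₈ * n₉ * x * i₁ + n₁ * n₉ * x * i₈ - n₁ * n₈ * x * i₉)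
      (n₁ * n₈ * j₉ - n₈ * n₉ * j₁ - n₁ * n₉ * j₈) (n₁ * n₈ * r₉ - n₈ * n₉ * r₁)
      (n₁ * n₈ * r₉ - n₁ * n₉ * r₈) (n₈ * (y * r₁₀ - x * i₁₀) + n₁₀ * x * i₈)
      (n₈ * (j₁₀ - r₁₀) - n₁₀ * j₈) (n₈ * r₁₀ - n₁₀ * r₈) ≠ 0)
    (hn₁ : n₁ ≠ 0) (hn₈ : n₈ ≠ 0)
    (h₁ : l₁ * n₁ - x * k * i₁ + m₁ * r₁ + β * j₁ = 0)
    (h₄ : l₁ * n₄ - x * k * i₄ + (m₁ + (y * k - β)) * r₄ + β * j₄ = 0)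
    (h₅ : (l₁ + x * k) * n₅ - x * k * i₅ + (m₁ + m₃) * r₅ = 0)
    (h₇ : (l₄ + x * k) * n₇ - x * k * i₇ + (m₃ + m₄) * r₇ + β * j₇ = 0)
    (h₈ : l₄ * n₈ - x * k * i₈ + m₄ * r₈ + β * j₈ = 0)
    (h₉ : (l₁ + l₄) * n₉ - x * k * i₉ + (m₁ + m₄) * r₉ + β * j₉ = 0)
    (h₁₀ : l₄ * n₁₀ - x * k * i₁₀ + (y * k - β + m₄) * r₁₀ + β * j₁₀ = 0) :
    l₁ = 0 ∧ l₄ = 0 ∧ k = 0 ∧ β = 0 ∧ m₁ = 0 ∧ m₃ = 0 ∧ m₄ = 0 := by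
  obtain ⟨rfl, rfl, rfl, rfl, rfl⟩ := eq_zero_of_sparseDet_ne_zero hdet (k := k) (β := β)
    (m₁ := m₁) (m₃ := m₃) (m₄ := m₄) (by linear_combination n₁ * h₄ - n₄ * h₁)
    (by linear_combination n₁ * h₅ - n₅ * h₁) (by linear_combination n₈ * h₇ - n₇ * h₈)
    (by linear_combination n₁ * n₈ * h₉ - n₈ * n₉ * h₁ - n₁ * n₉ * h₈)
    (by linear_combination n₈ * h₁₀ - n₁₀ * h₈)
  simp_all

/-- The tangential part of the relation that a dependency between the derivatives of `F₅` induces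
on a single block, where `(p, q)` is the block of `v₅` and `l`, `m`, `α`, `β` collect the
coefficients of `∂ᵢ`, `∂ᵢ∂_z`, `∂_z` and `∂_z∂_z`. -/
def NormalRel (l m α β p q p' q' p'' q'' : ℝ) : Prop :=
  l * (p * p + q * q) + α * (p * q' - q * p') + m * (p * p' + q * q') +
    β * (p * q'' - q * p'') = 0

/-- The tangential relations on the ten blocks, at a point with `sin z = s` and `cos z = c`. -/
structure NormalSystem (s c l₁ l₂ l₃ l₄ m₁ m₂ m₃ m₄ α β : ℝ) : Prop where
  rel₁ : NormalRel l₁ m₁ α β 2 (1 + s) 0 c 0 (-s)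
  rel₂ : NormalRel l₂ m₂ α β c (1 / 2 + s) (-s) c (-c) (-s)
  rel₃ : NormalRel l₃ m₃ α β c s (-s) c (-c) (-s)
  rel₁₂ : NormalRel (l₁ + l₂) (m₁ + m₂) α β c (2 - c) (-s) s (-c) c
  rel₁₃ : NormalRel (l₁ + l₃) (m₁ + m₃) α β (-2 * s - 5 * c) s (-2 * c + 5 * s) c
    (2 * s + 5 * c) (-s)
  rel₂₃ : NormalRel (l₂ + l₃) (m₂ + m₃) α β c s (-s) c (-c) (-s)
  rel₃₄ : NormalRel (l₃ + l₄) (m₃ + m₄) α β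
    c (-20 + 9 * s + 13 * c - 7 * (2 * s * c) + 3 * (2 * c ^ 2 - 1))
    (-s) (9 * c - 13 * s - 14 * (2 * c ^ 2 - 1) - 6 * (2 * s * c))
    (-c) (-9 * s - 13 * c + 28 * (2 * s * c) - 12 * (2 * c ^ 2 - 1))
  rel₄ : NormalRel l₄ m₄ α β (10 - 7 * s) (2 + 4 * s - 6 * c) (-7 * c) (4 * c + 6 * s)
    (7 * s) (-4 * s + 6 * c)
  rel₁₄ : NormalRel (l₁ + l₄) (m₁ + m₄) α β (-5 + 3 * s + 5 * c) (-9 + 15 * s + 2 * c)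
    (3 * c - 5 * s) (15 * c - 2 * s) (-3 * s - 5 * c) (-15 * s - 2 * c)
  rel₂₄ : NormalRel (l₂ + l₄) (m₂ + m₄) α β (-1 + 8 * s) (-2 + 6 * c) (8 * c) (-6 * s)
    (-8 * s) (-6 * c)

/-- The vanishing of all coefficients in a `NormalSystem`. -/
def CoeffsVanish (l₁ l₂ l₃ l₄ m₁ m₂ m₃ m₄ α β : ℝ) : Prop :=
  (l₁ = 0 ∧ l₂ = 0 ∧ l₃ = 0 ∧ l₄ = 0) ∧ (m₁ = 0 ∧ m₂ = 0 ∧ m₃ = 0 ∧ m₄ = 0) ∧ α = 0 ∧ β = 0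

theorem NormalSystem.coeffsVanish_pole {l₁ l₂ l₃ l₄ m₁ m₂ m₃ m₄ α β : ℝ}
    (hS : NormalSystem 0 (-1) l₁ l₂ l₃ l₄ m₁ m₂ m₃ m₄ α β) :
    CoeffsVanish l₁ l₂ l₃ l₄ m₁ m₂ m₃ m₄ α β := by
  obtain ⟨h₁, h₂, h₃, h₁₂, h₁₃, h₂₃, h₃₄, h₄, h₁₄, h₂₄⟩ := hS
  norm_num [NormalRel] at h₁ h₂ h₃ h₁₂ h₁₃ h₂₃ h₃₄ h₄ h₁₄ h₂₄
  refine ⟨⟨?_, ?_, ?_, ?_⟩, ⟨?_, ?_, ?_, ?_⟩, ?_, ?_⟩ <;> linarith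

theorem NormalSystem.relations {s c l₁ l₂ l₃ l₄ m₁ m₂ m₃ m₄ α β : ℝ} (hsc : s ^ 2 + c ^ 2 = 1)
    (hS : NormalSystem s c l₁ l₂ l₃ l₄ m₁ m₂ m₃ m₄ α β) :
    l₂ = 0 ∧ l₃ = -α ∧ α * (2 + s) + (m₂ + β) * c = 0 := by
  obtain ⟨-, h₂, h₃, -, -, h₂₃, -, -, -, -⟩ := hS
  simp only [NormalRel] at h₂ h₃ h₂₃
  have hl₃ : l₃ = -α := by linear_combination h₃ - (l₃ + α) * hsc
  have hl₂ : l₂ = 0 := by linear_combination h₂₃ - hl₃ - (l₂ + l₃ + α) * hsc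
  refine ⟨hl₂, hl₃, ?_⟩
  subst hl₂
  linear_combination 2 * h₂ - 2 * α * hsc

set_option maxHeartbeats 4000000 in
theorem sparseDet_chart (t : ℝ) {n₁ i₁ r₁ j₁ n₄ i₄ r₄ j₄ n₅ i₅ r₅ n₇ i₇ r₇ j₇ n₈ i₈ r₈ j₈
      n₉ i₉ r₉ j₉ n₁₀ i₁₀ r₁₀ j₁₀ x y : ℝ}
    (hn₁ : n₁ = 5 + 4*t + 14*t^2 + 4*t^3 + 5*t^4) (hi₁ : i₁ = 2 - 2*t^4)
    (hr₁ : r₁ = 1 + 2*t - 2*t^3 - t^4) (hj₁ : j₁ = -4*t - 4*t^3)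
    (hn₄ : n₄ = 2 + 4*t^2 + 10*t^4) (hi₄ : i₄ = 4*t + 4*t^3)
    (hr₄ : r₄ = 8*t^3) (hj₄ : j₄ = 2 - 2*t^4)
    (hn₅ : n₅ = 25 + 40*t - 30*t^2 - 40*t^3 + 25*t^4) (hi₅ : i₅ = -5 - 10*t^2 - 5*t^4)
    (hr₅ : r₅ = 10 - 40*t - 60*t^2 + 40*t^3 + 10*t^4)
    (hn₇ : n₇ = 17 + 80*t + 564*t^2 + 792*t^3 + 2682*t^4 - 4736*t^5 + 5596*t^6 - 2760*t^7
      + 901*t^8)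
    (hi₇ : i₇ = -5 - 58*t + 64*t^2 - 126*t^3 + 54*t^4 - 126*t^5 + 8*t^6 - 58*t^7 + 23*t^8)
    (hr₇ : r₇ = 20 + 248*t + 454*t^2 + 1836*t^3 - 6910*t^4 + 5712*t^5 - 1278*t^6 - 996*t^7
      + 690*t^8)
    (hj₇ : j₇ = -29 + 84*t + 14*t^2 - 84*t^3 - 84*t^5 - 14*t^6 + 84*t^7 + 29*t^8)
    (hn₈ : n₈ = 116 - 344*t + 396*t^2 - 152*t^3 + 164*t^4)
    (hi₈ : i₈ = 12 + 120*t - 84*t^2 + 120*t^3 - 96*t^4)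
    (hr₈ : r₈ = -86 + 82*t + 144*t^2 - 34*t^3 + 38*t^4)
    (hj₈ : j₈ = 60 - 108*t - 108*t^3 - 60*t^4)
    (hn₉ : n₉ = 49 - 420*t + 1090*t^2 - 780*t^3 + 221*t^4)
    (hi₉ : i₉ = 21 - 70*t + 138*t^2 - 70*t^3 + 117*t^4)
    (hr₉ : r₉ = -105 + 496*t - 270*t^2 - 324*t^3 + 195*t^4)
    (hj₉ : j₉ = -35 + 96*t + 96*t^3 + 35*t^4)
    (hn₁₀ : n₁₀ = 17 - 32*t + 194*t^2 - 32*t^3 + 65*t^4)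
    (hi₁₀ : i₁₀ = -32 + 12*t - 96*t^2 + 12*t^3 - 64*t^4)
    (hr₁₀ : r₁₀ = -8 + 80*t - 32*t^3 + 8*t^4)
    (hj₁₀ : j₁₀ = 6 - 32*t - 32*t^3 - 6*t^4)
    (hx : x = 1 - t^2) (hy : y = 2 + 2*t + 2*t^2) :
    sparseDet (n₁ * (y * r₄ - x * i₄) + n₄ * x * i₁) (n₁ * (j₄ - r₄) - n₄ * j₁)
      (n₁ * r₄ - n₄ * r₁) (n₁ * x * (n₅ - i₅) + n₅ * x * i₁) (-(n₅ * j₁)) (n₁ * r₅ - n₅ * r₁)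
      (n₁ * r₅) (n₈ * x * (n₇ - i₇) + n₇ * x * i₈) (n₈ * j₇ - n₇ * j₈) (n₈ * r₇)
      (n₈ * r₇ - n₇ * r₈) (n₈ * n₉ * x * i₁ + n₁ * n₉ * x * i₈ - n₁ * n₈ * x * i₉)
      (n₁ * n₈ * j₉ - n₈ * n₉ * j₁ - n₁ * n₉ * j₈) (n₁ * n₈ * r₉ - n₈ * n₉ * r₁)
      (n₁ * n₈ * r₉ - n₁ * n₉ * r₈) (n₈ * (y * r₁₀ - x * i₁₀) + n₁₀ * x * i₈)
      (n₈ * (j₁₀ - r₁₀) - n₁₀ * j₈) (n₈ * r₁₀ - n₁₀ * r₈) =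
      -40 * (1 + t ^ 2) ^ 2 * (n₁ ^ 2 * n₈ ^ 2) * evalList detCoeffs t := by
  subst_vars
  simp only [sparseDet, detCoeffs, evalList]
  push_cast
  ring

theorem NormalSystem.coeffsVanish_chart {t s c l₁ l₂ l₃ l₄ m₁ m₂ m₃ m₄ α β : ℝ}
    (hs : s = 2 * t / (1 + t ^ 2)) (hc : c = (1 - t ^ 2) / (1 + t ^ 2))
    (hS : NormalSystem s c l₁ l₂ l₃ l₄ m₁ m₂ m₃ m₄ α β) :
    CoeffsVanish l₁ l₂ l₃ l₄ m₁ m₂ m₃ m₄ α β := by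
  have hsc : s ^ 2 + c ^ 2 = 1 := by
    rw [hs, hc]
    field_simp
    ring
  obtain ⟨rfl, rfl, hα⟩ := hS.relations hsc
  obtain ⟨h₁, -, -, h₁₂, h₁₃, -, h₃₄, h₄, h₁₄, h₂₄⟩ := hS
  have hy : 2 + 2 * t + 2 * t ^ 2 ≠ 0 := by nlinarith [sq_nonneg (t + 1), sq_nonneg t]
  obtain ⟨k, hk⟩ : ∃ k, m₂ + β = (2 + 2 * t + 2 * t ^ 2) * k :=
    ⟨(m₂ + β) / (2 + 2 * t + 2 * t ^ 2), (mul_div_cancel₀ _ hy).symm⟩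
  have hα' : α = -((1 - t ^ 2) * k) := by
    have : (2 + 2 * t + 2 * t ^ 2) * (α + (1 - t ^ 2) * k) = 0 := by
      linear_combination (norm := skip) (1 + t ^ 2) * hα - (1 - t ^ 2) * hk
      rw [hs, hc]
      field_simp
      ring
    linarith [(mul_eq_zero.1 this).resolve_left hy]
  have hm₂ : m₂ = (2 + 2 * t + 2 * t ^ 2) * k - β := by linarith
  subst hα' hm₂
  simp only [NormalRel] at h₁ h₁₂ h₁₃ h₃₄ h₄ h₁₄ h₂₄
  have hn₁ : 5 + 4*t + 14*t^2 + 4*t^3 + 5*t^4 ≠ 0 := by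
    have : 5 + 4*t + 14*t^2 + 4*t^3 + 5*t^4 = (2 + 2 * t ^ 2) ^ 2 + (1 + 2 * t + t ^ 2) ^ 2 := by
      ring
    rw [this]
    positivity
  have hn₈ : 116 - 344*t + 396*t^2 - 152*t^3 + 164*t^4 ≠ 0 := by
    have : 116 - 344*t + 396*t^2 - 152*t^3 + 164*t^4 =
        (10 * (t - 7 / 10) ^ 2 + 51 / 10) ^ 2 + (-4 + 8 * t + 8 * t ^ 2) ^ 2 := by
      ring
    rw [this]
    positivity
  have hdet := sparseDet_chart t rfl rfl rfl rfl rfl rfl rfl rfl rfl rfl rfl rfl rfl rfl rfl rfl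
    rfl rfl rfl rfl rfl rfl rfl rfl rfl rfl rfl rfl rfl
  have hpos := (evalList_detCoeffs_pos t).ne'
  obtain ⟨rfl, rfl, rfl, rfl, rfl, rfl, rfl⟩ := eq_zero_of_normal_equations
    (l₁ := l₁) (l₄ := l₄) (k := k) (β := β) (m₁ := m₁) (m₃ := m₃) (m₄ := m₄)
    (by
      rw [hdet]
      have : (1 + t ^ 2 : ℝ) ≠ 0 := by positivity
      simp only [ne_eq, mul_eq_zero, not_or]
      exact ⟨⟨⟨by norm_num, pow_ne_zero 2 this⟩, pow_ne_zero 2 hn₁, pow_ne_zero 2 hn₈⟩, hpos⟩)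
    hn₁ hn₈
    (by
      linear_combination (norm := skip) (1 + t ^ 2) ^ 2 * h₁
      rw [hs, hc]
      field_simp
      ring)
    (by
      linear_combination (norm := skip) (1 + t ^ 2) ^ 2 * h₁₂
      rw [hs, hc]
      field_simp
      ring)
    (by
      linear_combination (norm := skip) (1 + t ^ 2) ^ 2 * h₁₃
      rw [hs, hc]
      field_simp
      ring)
    (by
      linear_combination (norm := skip) (1 + t ^ 2) ^ 4 * h₃₄
      rw [hs, hc]
      field_simp
      ring)
    (by
      linear_combination (norm := skip) (1 + t ^ 2) ^ 2 * h₄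
      rw [hs, hc]
      field_simp
      ring)
    (by
      linear_combination (norm := skip) (1 + t ^ 2) ^ 2 * h₁₄
      rw [hs, hc]
      field_simp
      ring)
    (by
      linear_combination (norm := skip) (1 + t ^ 2) ^ 2 * h₂₄
      rw [hs, hc]
      field_simp
      ring)
  simp [CoeffsVanish]

theorem NormalSystem.coeffsVanish {s c l₁ l₂ l₃ l₄ m₁ m₂ m₃ m₄ α β : ℝ} (hsc : s ^ 2 + c ^ 2 = 1)
    (hS : NormalSystem s c l₁ l₂ l₃ l₄ m₁ m₂ m₃ m₄ α β) :
    CoeffsVanish l₁ l₂ l₃ l₄ m₁ m₂ m₃ m₄ α β := by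
  rcases eq_or_ne c (-1) with rfl | hc
  · obtain rfl : s = 0 := by nlinarith
    exact hS.coeffsVanish_pole
  have hc' : 1 + c ≠ 0 := fun h => hc (by linarith)
  have key : 1 + (s / (1 + c)) ^ 2 = 2 / (1 + c) := by
    field_simp
    linear_combination hsc
  refine hS.coeffsVanish_chart (t := s / (1 + c)) ?_ ?_
  · rw [key]
    field_simp
  · rw [key]
    field_simp
    linear_combination hsc

/-- The relation that a dependency between the derivatives of `F₅` induces on a single block, where
`(p, q)` is the block of `v₅`, `Q` is the value of the quadratic form of the coefficients of
`∂ᵢ∂ⱼ`, and `l`, `m`, `α`, `β` collect the coefficients of `∂ᵢ`, `∂ᵢ∂_z`, `∂_z` and `∂_z∂_z`. -/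
def BlockRel (Q l m α β p q p' q' p'' q'' : ℝ) : Prop :=
  -(Q * p) - l * q + α * p' - m * q' + β * p'' = 0 ∧
    -(Q * q) + l * p + α * q' + m * p' + β * q'' = 0

theorem BlockRel.normalRel {Q l m α β p q p' q' p'' q'' : ℝ}
    (hB : BlockRel Q l m α β p q p' q' p'' q'') : NormalRel l m α β p q p' q' p'' q'' := by
  unfold NormalRel
  linear_combination p * hB.2 - q * hB.1

theorem BlockRel.eq_zero {Q l m α β p q p' q' p'' q'' : ℝ}
    (hB : BlockRel Q l m α β p q p' q' p'' q'') (hl : l = 0) (hm : m = 0) (hα : α = 0)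
    (hβ : β = 0) (hpq : p = 0 → q ≠ 0) : Q = 0 := by
  subst hl hm hα hβ
  obtain ⟨h₁, h₂⟩ := hB
  by_contra hQ
  have hp : p = 0 := (mul_eq_zero.1 (by linarith : Q * p = 0)).resolve_left hQ
  exact hpq hp ((mul_eq_zero.1 (by linarith : Q * q = 0)).resolve_left hQ)

/-- The first and second derivatives of `F₅`, up to a rotation of the blocks, where `v`, `dv`, `ddv`
are the values of `v₅` and its derivatives. -/
def derivFamily (v dv ddv : Fin 20 → ℝ) : Fin 20 → Fin 20 → ℝ :=
  ![quarterTurn freq₁ v, quarterTurn freq₂ v, quarterTurn freq₃ v, quarterTurn freq₄ v, dv,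
    quarterTurn freq₁ (quarterTurn freq₁ v), quarterTurn freq₂ (quarterTurn freq₁ v),
    quarterTurn freq₃ (quarterTurn freq₁ v), quarterTurn freq₄ (quarterTurn freq₁ v),
    quarterTurn freq₂ (quarterTurn freq₂ v), quarterTurn freq₃ (quarterTurn freq₂ v),
    quarterTurn freq₄ (quarterTurn freq₂ v), quarterTurn freq₃ (quarterTurn freq₃ v),
    quarterTurn freq₄ (quarterTurn freq₃ v), quarterTurn freq₄ (quarterTurn freq₄ v),
    quarterTurn freq₁ dv, quarterTurn freq₂ dv, quarterTurn freq₃ dv, quarterTurn freq₄ dv, ddv]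

/-- The value of the quadratic form of the coefficients of `∂ᵢ∂ⱼ` on the frequencies of block
`k`. -/
def quadForm (g : Fin 20 → ℝ) : Fin 10 → ℝ :=
  ![g 5, g 9, g 12, g 5 + g 6 + g 9, g 5 + g 7 + g 12, g 9 + g 10 + g 12, g 12 + g 13 + g 14,
    g 14, g 5 + g 8 + g 14, g 9 + g 11 + g 14]

theorem blockRel_of_sum_eq_zero {v dv ddv g : Fin 20 → ℝ}
    (hg : ∑ i, g i • derivFamily v dv ddv i = 0) (k : Fin 10) :
    BlockRel (quadForm g k) (phase (g 0) (g 1) (g 2) (g 3) k)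
      (phase (g 15) (g 16) (g 17) (g 18) k) (g 4) (g 19)
      (v (finProdFinEquiv (k, (0 : Fin 2)))) (v (finProdFinEquiv (k, (1 : Fin 2))))
      (dv (finProdFinEquiv (k, (0 : Fin 2)))) (dv (finProdFinEquiv (k, (1 : Fin 2))))
      (ddv (finProdFinEquiv (k, (0 : Fin 2)))) (ddv (finProdFinEquiv (k, (1 : Fin 2)))) := by
  have h₀ := congr_fun hg (finProdFinEquiv (k, (0 : Fin 2)))
  have h₁ := congr_fun hg (finProdFinEquiv (k, (1 : Fin 2)))
  fin_cases k <;>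
  · simp [Fin.sum_univ_succ, derivFamily, quarterTurn, freq₁, freq₂, freq₃, freq₄,
      finProdFinEquiv] at h₀ h₁
    simp [quadForm, phase, finProdFinEquiv]
    exact ⟨by linear_combination h₀, by linear_combination h₁⟩

theorem linearIndependent_derivFamily (z : ℝ) :
    LinearIndependent ℝ (derivFamily (v₅ z) (v₅' z) (v₅'' z)) := by
  rw [Fintype.linearIndependent_iff]
  intro g hg
  have hB := blockRel_of_sum_eq_zero hg
  have b₁ := hB 0
  have b₂ := hB 1
  have b₃ := hB 2
  have b₁₂ := hB 3
  have b₁₃ := hB 4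
  have b₂₃ := hB 5
  have b₃₄ := hB 6
  have b₄ := hB 7
  have b₁₄ := hB 8
  have b₂₄ := hB 9
  clear hB
  have hsc := sin_sq_add_cos_sq z
  simp [quadForm, phase, finProdFinEquiv, v₅, v₅', v₅'', h, h', h'', Real.sin_two_mul,
    Real.cos_two_mul] at b₁ b₂ b₃ b₁₂ b₁₃ b₂₃ b₃₄ b₄ b₁₄ b₂₄
  generalize sin z = s at *
  generalize cos z = c at *
  have hS : NormalSystem s c (g 0) (g 1) (g 2) (g 3) (g 15) (g 16) (g 17) (g 18) (g 4) (g 19) := by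
    constructor
    · exact b₁.normalRel
    · convert b₂.normalRel using 1; ring
    · exact b₃.normalRel
    · exact b₁₂.normalRel
    · convert b₁₃.normalRel using 1 <;> ring
    · exact b₂₃.normalRel
    · convert b₃₄.normalRel using 1; ring
    · convert b₄.normalRel using 1 <;> ring
    · convert b₁₄.normalRel using 1 <;> ring
    · convert b₂₄.normalRel using 1 <;> ring
  obtain ⟨⟨hl₁, hl₂, hl₃, hl₄⟩, ⟨hm₁, hm₂, hm₃, hm₄⟩, hα, hβ⟩ := hS.coeffsVanish hsc
  have q₁ := b₁.eq_zero hl₁ hm₁ hα hβ (by norm_num)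
  have q₂ := b₂.eq_zero hl₂ hm₂ hα hβ (by rintro rfl _; nlinarith)
  have q₃ := b₃.eq_zero hl₃ hm₃ hα hβ (by rintro rfl rfl; simp at hsc)
  have q₁₂ := b₁₂.eq_zero (by simp [hl₁, hl₂]) (by simp [hm₁, hm₂]) hα hβ (by rintro rfl; norm_num)
  have q₁₃ := b₁₃.eq_zero (by simp [hl₁, hl₃]) (by simp [hm₁, hm₃]) hα hβ
    (by rintro _ rfl; nlinarith)
  have q₂₃ := b₂₃.eq_zero (by simp [hl₂, hl₃]) (by simp [hm₂, hm₃]) hα hβ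
    (by rintro rfl rfl; simp at hsc)
  have q₃₄ := b₃₄.eq_zero (by simp [hl₃, hl₄]) (by simp [hm₃, hm₄]) hα hβ
    (by rintro rfl _; nlinarith)
  have q₄ := b₄.eq_zero hl₄ hm₄ hα hβ (by intro; nlinarith)
  have q₁₄ := b₁₄.eq_zero (by simp [hl₁, hl₄]) (by simp [hm₁, hm₄]) hα hβ (by
    intro h₁ h₂
    have hc : c = 16 / 23 := by linarith
    have hs : s = 5 / 3 - 5 / 3 * (16 / 23) := by linarith
    norm_num [hc, hs] at hsc)
  have q₂₄ := b₂₄.eq_zero (by simp [hl₂, hl₄]) (by simp [hm₂, hm₄]) hα hβ (by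
    intro h₁ h₂
    have hs : s = 1 / 8 := by linarith
    have hc : c = 1 / 3 := by linarith
    norm_num [hc, hs] at hsc)
  intro i
  fin_cases i <;> simp only [Fin.reduceFinMk, Fin.zero_eta, Fin.mk_one] <;> linarith

set_option maxHeartbeats 1000000 in
/-- `F₅` is free: at every point the twenty vectors of first and second
partial derivatives are linearly independent in `ℝ²⁰` (the critical dimension
`q₅ = 5·(5+3)/2 = 20`). Moreover `F₅` is smooth and `2π`-periodic in each variable,
hence induces a smooth free map of the 5-torus `T⁵` into `ℝ²⁰`. -/
theorem F₅_free :
    (∀ x₁ x₂ x₃ x₄ z : ℝ, LinearIndependent ℝ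
      ![deriv (fun t => F₅ t x₂ x₃ x₄ z) x₁,
      deriv (fun t => F₅ x₁ t x₃ x₄ z) x₂,
      deriv (fun t => F₅ x₁ x₂ t x₄ z) x₃,
      deriv (fun t => F₅ x₁ x₂ x₃ t z) x₄,
      deriv (fun t => F₅ x₁ x₂ x₃ x₄ t) z,
      deriv (fun t => deriv (fun s => F₅ s x₂ x₃ x₄ z) t) x₁,
      deriv (fun t => deriv (fun s => F₅ s t x₃ x₄ z) x₁) x₂,
      deriv (fun t => deriv (fun s => F₅ s x₂ t x₄ z) x₁) x₃,
      deriv (fun t => deriv (fun s => F₅ s x₂ x₃ t z) x₁) x₄,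
      deriv (fun t => deriv (fun s => F₅ x₁ s x₃ x₄ z) t) x₂,
      deriv (fun t => deriv (fun s => F₅ x₁ s t x₄ z) x₂) x₃,
      deriv (fun t => deriv (fun s => F₅ x₁ s x₃ t z) x₂) x₄,
      deriv (fun t => deriv (fun s => F₅ x₁ x₂ s x₄ z) t) x₃,
      deriv (fun t => deriv (fun s => F₅ x₁ x₂ s t z) x₃) x₄,
      deriv (fun t => deriv (fun s => F₅ x₁ x₂ x₃ s z) t) x₄,
      deriv (fun t => deriv (fun s => F₅ s x₂ x₃ x₄ t) x₁) z,
      deriv (fun t => deriv (fun s => F₅ x₁ s x₃ x₄ t) x₂) z,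
      deriv (fun t => deriv (fun s => F₅ x₁ x₂ s x₄ t) x₃) z,
      deriv (fun t => deriv (fun s => F₅ x₁ x₂ x₃ s t) x₄) z,
      deriv (fun t => deriv (fun s => F₅ x₁ x₂ x₃ x₄ s) t) z])
    ∧ ContDiff ℝ (⊤ : ℕ∞) (fun p : ℝ × ℝ × ℝ × ℝ × ℝ => F₅ p.1 p.2.1 p.2.2.1 p.2.2.2.1 p.2.2.2.2)
    ∧ (∀ x₁ x₂ x₃ x₄ z : ℝ,
        F₅ (x₁ + 2 * π) x₂ x₃ x₄ z = F₅ x₁ x₂ x₃ x₄ z ∧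
        F₅ x₁ (x₂ + 2 * π) x₃ x₄ z = F₅ x₁ x₂ x₃ x₄ z ∧
        F₅ x₁ x₂ (x₃ + 2 * π) x₄ z = F₅ x₁ x₂ x₃ x₄ z ∧
        F₅ x₁ x₂ x₃ (x₄ + 2 * π) z = F₅ x₁ x₂ x₃ x₄ z ∧
        F₅ x₁ x₂ x₃ x₄ (z + 2 * π) = F₅ x₁ x₂ x₃ x₄ z) := by
  refine ⟨fun x₁ x₂ x₃ x₄ z => ?_, contDiff_F₅, F₅_periodic⟩
  simp only [F₅_eq, deriv_rotBlocks_phase₁, deriv_rotBlocks_phase₂, deriv_rotBlocks_phase₃,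
    deriv_rotBlocks_phase₄, deriv_rotBlocks_v₅, deriv_rotBlocks_v₅', deriv_rotBlocks_quarterTurn_v₅]
  convert (linearIndependent_derivFamily z).map' _ (rotBlocksₗ_ker (phase x₁ x₂ x₃ x₄)) using 1
  · ext i : 1
    fin_cases i <;> rfl
  all_goals rfl
end

section
/- Let A(x) denote the 2×2 rotation matrix ((cos x, −sin x),(sin x, cos x)). Let R(x) be the 9×9 block-diagonal matrix diag(A(x), A(2x), 1, A(3x), A(4x)) and let v : ℝ → ℝ⁹ be v(y) = (2, 1+sin y, cos y, 1/2+sin y, cos y, sin(2y), cos(2y), sin(2y), 7 − 2 sin(2y)). Define F : ℝ² → ℝ⁹ by F(x,y) = R(x)·v(y). Then F is 3-free: at every point (x,y) ∈ ℝ², the nine vectors ∂ₓF, ∂ᵧF, ∂ₓₓF, ∂ₓᵧF, ∂ᵧᵧF, ∂ₓₓₓF, ∂ₓₓᵧF, ∂ₓᵧᵧF, ∂ᵧᵧᵧF ∈ ℝ⁹ are linearly independent. Since F is 2π-periodic in each variable, it induces a smooth 3-free map of the 2-torus T² into ℝ⁹, which is the critical dimension q_{2,3} = C(2+3,3) − 1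 = 9. -/
open Real Matrix

/-- The 9×9 block-diagonal rotation matrix `R(x) = diag(A(x), A(2x), 1, A(3x), A(4x))`,
where `A(t)` is the 2×2 rotation matrix `((cos t, −sin t),(sin t, cos t))`. -/
noncomputable def Rmat (x : ℝ) : Matrix (Fin 9) (Fin 9) ℝ :=
  !![cos (x), -sin (x), 0, 0, 0, 0, 0, 0, 0;
    sin (x), cos (x), 0, 0, 0, 0, 0, 0, 0;
    0, 0, cos (2 * x), -sin (2 * x), 0, 0, 0, 0, 0;
    0, 0, sin (2 * x), cos (2 * x), 0, 0, 0, 0, 0;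
    0, 0, 0, 0, 1, 0, 0, 0, 0;
    0, 0, 0, 0, 0, cos (3 * x), -sin (3 * x), 0, 0;
    0, 0, 0, 0, 0, sin (3 * x), cos (3 * x), 0, 0;
    0, 0, 0, 0, 0, 0, 0, cos (4 * x), -sin (4 * x);
    0, 0, 0, 0, 0, 0, 0, sin (4 * x), cos (4 * x)]

/-- The loop `v : ℝ → ℝ⁹`. -/
noncomputable def v (y : ℝ) : Fin 9 → ℝ :=
  ![2, 1 + sin y, cos y, 1 / 2 + sin y, cos y, sin (2 * y), cos (2 * y),
    sin (2 * y), 7 - 2 * sin (2 * y)]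

/-- The map `F(x,y) = R(x)·v(y) : ℝ² → ℝ⁹`. -/
noncomputable def F (x y : ℝ) : Fin 9 → ℝ := Rmat x *ᵥ v y

/-- The infinitesimal generator of the one-parameter group `Rmat`. -/
def rotGen : Matrix (Fin 9) (Fin 9) ℝ :=
  !![0, -1, 0, 0, 0, 0, 0, 0, 0;
    1, 0, 0, 0, 0, 0, 0, 0, 0;
    0, 0, 0, -2, 0, 0, 0, 0, 0;
    0, 0, 2, 0, 0, 0, 0, 0, 0;
    0, 0, 0, 0, 0, 0, 0, 0, 0;
    0, 0, 0, 0, 0, 0, -3, 0, 0;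
    0, 0, 0, 0, 0, 3, 0, 0, 0;
    0, 0, 0, 0, 0, 0, 0, 0, -4;
    0, 0, 0, 0, 0, 0, 0, 4, 0]

/-- The first derivative of `v`. -/
noncomputable def vDeriv (y : ℝ) : Fin 9 → ℝ :=
  ![0, cos y, -sin y, cos y, -sin y, 2 * cos (2 * y), -(2 * sin (2 * y)),
    2 * cos (2 * y), -(2 * (2 * cos (2 * y)))]

/-- The second derivative of `v`. -/
noncomputable def vDeriv₂ (y : ℝ) : Fin 9 → ℝ :=
  ![0, -sin y, -cos y, -sin y, -cos y, 2 * -(2 * sin (2 * y)), -(2 * (2 * cos (2 * y))),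
    2 * -(2 * sin (2 * y)), -(2 * (2 * -(2 * sin (2 * y))))]

/-- The third derivative of `v`. -/
noncomputable def vDeriv₃ (y : ℝ) : Fin 9 → ℝ :=
  ![0, -cos y, sin y, -cos y, sin y, 2 * -(2 * (2 * cos (2 * y))),
    -(2 * (2 * -(2 * sin (2 * y)))), 2 * -(2 * (2 * cos (2 * y))),
    -(2 * (2 * -(2 * (2 * cos (2 * y)))))]

/-- The partial derivatives of `F` of orders `1`, `2`, `3` at `(x, y)`, with the common
factor `Rmat x` removed. -/
noncomputable def jetFrame (y : ℝ) : Fin 9 → Fin 9 → ℝ :=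
  ![rotGen *ᵥ v y, vDeriv y, rotGen *ᵥ rotGen *ᵥ v y, rotGen *ᵥ vDeriv y, vDeriv₂ y,
    rotGen *ᵥ rotGen *ᵥ rotGen *ᵥ v y, rotGen *ᵥ rotGen *ᵥ vDeriv y, rotGen *ᵥ vDeriv₂ y,
    vDeriv₃ y]

lemma Rmat_mulVec (x : ℝ) (w : Fin 9 → ℝ) :
    Rmat x *ᵥ w = ![cos x * w 0 - sin x * w 1, sin x * w 0 + cos x * w 1,
      cos (2 * x) * w 2 - sin (2 * x) * w 3, sin (2 * x) * w 2 + cos (2 * x) * w 3, w 4,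
      cos (3 * x) * w 5 - sin (3 * x) * w 6, sin (3 * x) * w 5 + cos (3 * x) * w 6,
      cos (4 * x) * w 7 - sin (4 * x) * w 8, sin (4 * x) * w 7 + cos (4 * x) * w 8] := by
  ext i
  fin_cases i <;> simp [Rmat, Matrix.mulVec, dotProduct, Fin.sum_univ_succ] <;> rfl

lemma rotGen_mulVec (w : Fin 9 → ℝ) :
    rotGen *ᵥ w = ![-w 1, w 0, -(2 * w 3), 2 * w 2, 0, -(3 * w 6), 3 * w 5,
      -(4 * w 8), 4 * w 7] := by
  ext i
  fin_cases i <;> simp [rotGen, Matrix.mulVec, dotProduct, Fin.sum_univ_succ]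

lemma Rmat_mulVec_injective (x : ℝ) : Function.Injective (Rmat x).mulVec := by
  refine Function.LeftInverse.injective (g := (Rmat (-x)).mulVec) fun w => ?_
  rw [Rmat_mulVec, Rmat_mulVec]
  ext i
  fin_cases i <;> simp
  · linear_combination w 0 * cos_sq_add_sin_sq x
  · linear_combination w 1 * cos_sq_add_sin_sq x
  · linear_combination w 2 * cos_sq_add_sin_sq (2 * x)
  · linear_combination w 3 * cos_sq_add_sin_sq (2 * x)
  · linear_combination w 5 * cos_sq_add_sin_sq (3 * x)
  · linear_combination w 6 * cos_sq_add_sin_sq (3 * x)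
  · linear_combination w 7 * cos_sq_add_sin_sq (4 * x)
  · linear_combination w 8 * cos_sq_add_sin_sq (4 * x)

lemma hasDerivAt_mulVec (M : Matrix (Fin 9) (Fin 9) ℝ) {u : ℝ → Fin 9 → ℝ} {u' : Fin 9 → ℝ}
    {t : ℝ} (hu : HasDerivAt u u' t) : HasDerivAt (fun s => M *ᵥ u s) (M *ᵥ u') t :=
  (LinearMap.toContinuousLinearMap M.mulVecLin).hasFDerivAt.comp_hasDerivAt t hu

lemma hasDerivAt_cos_const_mul (k t : ℝ) :
    HasDerivAt (fun s => cos (k * s)) (-(k * sin (k * t))) t := by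
  simpa [mul_comm] using ((hasDerivAt_id t).const_mul k).cos

lemma hasDerivAt_sin_const_mul (k t : ℝ) :
    HasDerivAt (fun s => sin (k * s)) (k * cos (k * t)) t := by
  simpa [mul_comm] using ((hasDerivAt_id t).const_mul k).sin

lemma hasDerivAt_rotation_fst (k a b t : ℝ) :
    HasDerivAt (fun s => cos (k * s) * a - sin (k * s) * b)
      (cos (k * t) * -(k * b) - sin (k * t) * (k * a)) t :=
  (((hasDerivAt_cos_const_mul k t).mul_const a).sub
    ((hasDerivAt_sin_const_mul k t).mul_const b)).congr_deriv (by ring)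

lemma hasDerivAt_rotation_snd (k a b t : ℝ) :
    HasDerivAt (fun s => sin (k * s) * a + cos (k * s) * b)
      (sin (k * t) * -(k * b) + cos (k * t) * (k * a)) t :=
  (((hasDerivAt_sin_const_mul k t).mul_const a).add
    ((hasDerivAt_cos_const_mul k t).mul_const b)).congr_deriv (by ring)

lemma hasDerivAt_Rmat_mulVec (w : Fin 9 → ℝ) (t : ℝ) :
    HasDerivAt (fun s => Rmat s *ᵥ w) (Rmat t *ᵥ rotGen *ᵥ w) t := by
  have h₀ := hasDerivAt_rotation_fst 1 (w 0) (w 1) t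
  have h₁ := hasDerivAt_rotation_snd 1 (w 0) (w 1) t
  simp only [one_mul] at h₀ h₁
  refine hasDerivAt_pi.2 fun i => ?_
  simp only [Rmat_mulVec, rotGen_mulVec]
  fin_cases i
  · exact h₀
  · exact h₁
  · exact hasDerivAt_rotation_fst 2 (w 2) (w 3) t
  · exact hasDerivAt_rotation_snd 2 (w 2) (w 3) t
  · exact hasDerivAt_const t (w 4)
  · exact hasDerivAt_rotation_fst 3 (w 5) (w 6) t
  · exact hasDerivAt_rotation_snd 3 (w 5) (w 6) t
  · exact hasDerivAt_rotation_fst 4 (w 7) (w 8) t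
  · exact hasDerivAt_rotation_snd 4 (w 7) (w 8) t

lemma hasDerivAt_v (t : ℝ) : HasDerivAt v (vDeriv t) t := by
  have hs := hasDerivAt_sin t
  have hc := hasDerivAt_cos t
  have hs₂ := hasDerivAt_sin_const_mul 2 t
  have hc₂ := hasDerivAt_cos_const_mul 2 t
  refine hasDerivAt_pi.2 fun i => ?_
  fin_cases i
  · exact hasDerivAt_const t 2
  · exact hs.const_add 1
  · exact hc
  · exact hs.const_add (1 / 2)
  · exact hc
  · exact hs₂
  · exact hc₂
  · exact hs₂
  · exact (hs₂.const_mul 2).const_sub 7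

lemma hasDerivAt_vDeriv (t : ℝ) : HasDerivAt vDeriv (vDeriv₂ t) t := by
  have hs := hasDerivAt_sin t
  have hc := hasDerivAt_cos t
  have hs₂ := hasDerivAt_sin_const_mul 2 t
  have hc₂ := hasDerivAt_cos_const_mul 2 t
  refine hasDerivAt_pi.2 fun i => ?_
  fin_cases i
  · exact hasDerivAt_const t 0
  · exact hc
  · exact hs.neg
  · exact hc
  · exact hs.neg
  · exact hc₂.const_mul 2
  · exact (hs₂.const_mul 2).neg
  · exact hc₂.const_mul 2
  · exact ((hc₂.const_mul 2).const_mul 2).neg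

lemma hasDerivAt_vDeriv₂ (t : ℝ) : HasDerivAt vDeriv₂ (vDeriv₃ t) t := by
  have hs := hasDerivAt_sin t
  have hc := hasDerivAt_cos t
  have hs₂ := hasDerivAt_sin_const_mul 2 t
  have hc₂ := hasDerivAt_cos_const_mul 2 t
  refine hasDerivAt_pi.2 fun i => ?_
  fin_cases i
  · exact hasDerivAt_const t 0
  · exact hs.neg
  · exact hc.neg.congr_deriv (neg_neg _)
  · exact hs.neg
  · exact hc.neg.congr_deriv (neg_neg _)
  · exact (hs₂.const_mul 2).neg.const_mul 2
  · exact (hc₂.const_mul 2).const_mul 2 |>.neg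
  · exact (hs₂.const_mul 2).neg.const_mul 2
  · exact ((hs₂.const_mul 2).neg.const_mul 2 |>.const_mul 2).neg

lemma deriv_Rmat_mulVec (w : Fin 9 → ℝ) (t : ℝ) :
    deriv (fun s => Rmat s *ᵥ w) t = Rmat t *ᵥ rotGen *ᵥ w :=
  (hasDerivAt_Rmat_mulVec w t).deriv

/-- The linear system left after eliminating five of the nine coefficients from a linear
relation between the vectors of `jetFrame y`, where `s = sin y` and `c = cos y`. -/
def reducedSystem (s c : ℝ) : Matrix (Fin 4) (Fin 4) ℝ :=
  !![-12 - 12 * s - 28 * s * c,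
      6 * s + 3 * s ^ 2,
      -24 - 18 * c + 2 * s * c + 14 * s ^ 2 * c,
      -10 * s - 14 * s ^ 3;
    -28 * s,
      -3 * c,
      -42 + 2 * s + 14 * s ^ 2,
      14 * s * c;
    321 + 36 * c + 256 * s - 192 * s * c + 30 * s ^ 2 - 120 * s ^ 2 * c - 320 * s ^ 3,
      -216 - 9 * s + 24 * s * c + 12 * s ^ 2 - 48 * s ^ 2 * c + 18 * s ^ 3,
      72 + 18 * c + 64 * s - 114 * s * c - 272 * s ^ 2 - 12 * s ^ 2 * c - 32 * s ^ 3
        + 60 * s ^ 3 * c + 160 * s ^ 4,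
      12 + 256 * s * c + 18 * s ^ 2 + 160 * s ^ 3 * c - 60 * s ^ 4;
    15 - 36 * c + 64 * s - 48 * s * c - 30 * s ^ 2 + 120 * s ^ 2 * c - 80 * s ^ 3,
      6 + 9 * s + 6 * s * c - 12 * s ^ 2 - 12 * s ^ 2 * c - 18 * s ^ 3,
      -150 - 18 * c + 16 * s + 114 * s * c - 68 * s ^ 2 + 12 * s ^ 2 * c - 8 * s ^ 3
        - 60 * s ^ 3 * c + 40 * s ^ 4,
      -12 + 64 * s * c - 18 * s ^ 2 + 40 * s ^ 3 * c + 60 * s ^ 4]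

lemma abs_pow_mul_pow_le_one {s c : ℝ} (h : s ^ 2 + c ^ 2 = 1) (i j : ℕ) :
    |s ^ i * c ^ j| ≤ 1 := by
  have hs : |s| ≤ 1 := (sq_le_one_iff_abs_le_one s).1 (by nlinarith [sq_nonneg c])
  have hc : |c| ≤ 1 := (sq_le_one_iff_abs_le_one c).1 (by nlinarith [sq_nonneg s])
  rw [abs_mul, abs_pow, abs_pow]
  exact mul_le_one₀ (pow_le_one₀ (abs_nonneg s) hs) (by positivity) (pow_le_one₀ (abs_nonneg c) hc)

/-- The part of the determinant of `reducedSystem` that is left after a sum of two squares is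
split off is positive, since its constant term dominates. -/
lemma remainder_pos {s c : ℝ} (h : s ^ 2 + c ^ 2 = 1) :
    0 < 5475878 - 3480 * c + 12988 * s - 39780 * s * c - 54884 * s ^ 2 - 1224 * s ^ 2 * c
      + 110464 * s ^ 3 + 428048 * s ^ 3 * c + 281872 * s ^ 4 + 121248 * s ^ 4 * c - 337024 * s ^ 5
      - 1013824 * s ^ 5 * c - 248256 * s ^ 6 - 191360 * s ^ 6 * c + 230912 * s ^ 7
      + 665088 * s ^ 7 * c := by
  have H (i j : ℕ) := abs_le.1 (abs_pow_mul_pow_le_one h i j)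
  obtain ⟨l01, u01⟩ := H 0 1
  obtain ⟨l10, u10⟩ := H 1 0
  obtain ⟨l11, u11⟩ := H 1 1
  obtain ⟨l20, u20⟩ := H 2 0
  obtain ⟨l21, u21⟩ := H 2 1
  obtain ⟨l30, u30⟩ := H 3 0
  obtain ⟨l31, u31⟩ := H 3 1
  obtain ⟨l40, u40⟩ := H 4 0
  obtain ⟨l41, u41⟩ := H 4 1
  obtain ⟨l50, u50⟩ := H 5 0
  obtain ⟨l51, u51⟩ := H 5 1
  obtain ⟨l60, u60⟩ := H 6 0
  obtain ⟨l61, u61⟩ := H 6 1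
  obtain ⟨l70, u70⟩ := H 7 0
  obtain ⟨l71, u71⟩ := H 7 1
  linarith

lemma reducedSystem_det {s c : ℝ} (h : s ^ 2 + c ^ 2 = 1) :
    1024 * (reducedSystem s c).det = -108 * (
      (1810 - 677 * c - 627 * s + 3500 * s * c - 45278 * s ^ 2 - 3016 * s ^ 2 * c + 740 * s ^ 3
      - 8 * s ^ 3 * c + 56624 * s ^ 4) ^ 2 +
      (782 - 395 * c - 765 * s - 17022 * s * c - 3500 * s ^ 2 + 964 * s ^ 2 * c + 2904 * s ^ 3
      + 56624 * s ^ 3 * c - 8 * s ^ 4) ^ 2 +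
      (5475878 - 3480 * c + 12988 * s - 39780 * s * c - 54884 * s ^ 2 - 1224 * s ^ 2 * c
      + 110464 * s ^ 3 + 428048 * s ^ 3 * c + 281872 * s ^ 4 + 121248 * s ^ 4 * c - 337024 * s ^ 5
      - 1013824 * s ^ 5 * c - 248256 * s ^ 6 - 191360 * s ^ 6 * c + 230912 * s ^ 7
      + 665088 * s ^ 7 * c)) := by
  simp only [reducedSystem, det_succ_row_zero, Fin.sum_univ_succ]
  simp [Fin.succAbove]
  linear_combination (289303704 + 1058838480 * s + 230916096 * s * c - 637009920 * s * c ^ 2 + 35282088720 * s ^ 2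
      + 3375783936 * s ^ 2 * c + 287539200 * s ^ 2 * c ^ 2 - 11284038144 * s ^ 3
      + 3580010496 * s ^ 3 * c - 112066560 * s ^ 3 * c ^ 2 - 204606729792 * s ^ 4
      + 1536565248 * s ^ 4 * c - 934871040 * s ^ 4 * c ^ 2 + 4814088192 * s ^ 5
      + 1217544192 * s ^ 5 * c - 117964800 * s ^ 5 * c ^ 2 + 348384814848 * s ^ 6
      - 291225600 * s ^ 6 * c + 141557760 * s ^ 6 * c ^ 2 - 1244528640 * s ^ 7
      - 32440320 * s ^ 7 * c + 141557760 * s ^ 8) * h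

lemma reducedSystem_det_ne_zero {s c : ℝ} (h : s ^ 2 + c ^ 2 = 1) :
    (reducedSystem s c).det ≠ 0 := by
  intro h₀
  have hdet := reducedSystem_det h
  rw [h₀] at hdet
  nlinarith [remainder_pos h, hdet, sq_nonneg (1810 - 677 * c - 627 * s + 3500 * s * c - 45278 * s ^ 2 - 3016 * s ^ 2 * c + 740 * s ^ 3
      - 8 * s ^ 3 * c + 56624 * s ^ 4),
    sq_nonneg (782 - 395 * c - 765 * s - 17022 * s * c - 3500 * s ^ 2 + 964 * s ^ 2 * c + 2904 * s ^ 3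
      + 56624 * s ^ 3 * c - 8 * s ^ 4)]

lemma jetFrame_linearIndependent (y : ℝ) : LinearIndependent ℝ (jetFrame y) := by
  rw [Fintype.linearIndependent_iff]
  intro a ha
  have e₀ := congrFun ha 0
  have e₁ := congrFun ha 1
  have e₂ := congrFun ha 2
  have e₃ := congrFun ha 3
  have e₄ := congrFun ha 4
  have e₅ := congrFun ha 5
  have e₆ := congrFun ha 6
  have e₇ := congrFun ha 7
  have e₈ := congrFun ha 8
  simp [jetFrame, rotGen_mulVec, Fin.sum_univ_succ, v, vDeriv, vDeriv₂, vDeriv₃]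
    at e₀ e₁ e₂ e₃ e₄ e₅ e₆ e₇ e₈
  have hSC := sin_sq_add_cos_sq (2 * y)
  have h := sin_sq_add_cos_sq y
  have r₅ : -9 * a 2 + 6 * a 3 - 4 * a 4 = 0 := by
    linear_combination sin (2 * y) * e₅ + cos (2 * y) * e₆ -
      (-9 * a 2 + 6 * a 3 - 4 * a 4) * hSC
  have r₆ : 3 * a 0 - 2 * a 1 - 27 * a 5 + 18 * a 6 - 12 * a 7 + 8 * a 8 = 0 := by
    linear_combination sin (2 * y) * e₆ - cos (2 * y) * e₅ -
      (3 * a 0 - 2 * a 1 - 27 * a 5 + 18 * a 6 - 12 * a 7 + 8 * a 8) * hSC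
  rw [sin_two_mul, cos_two_mul'] at e₇ e₈
  set s := sin y
  set c := cos y
  obtain ⟨L, hL⟩ : ∃ L, L = (a 1 - a 8) * c - a 4 * s := ⟨_, rfl⟩
  obtain ⟨p, hp⟩ : ∃ p, p = a 0 - a 5 := ⟨_, rfl⟩
  obtain ⟨q, hq⟩ : ∃ q, q = 2 * a 0 - 8 * a 5 := ⟨_, rfl⟩
  have h₀ : a 0 = (8 * p - q) / 6 := by linear_combination (-8 * hp + hq) / 6
  have h₅ : a 5 = (2 * p - q) / 6 := by linear_combination (-2 * hp + hq) / 6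
  have h₄ : a 4 = -(L * s) := by
    linear_combination -c * e₄ + s * hL - a 4 * h
  have h₃ : a 3 = 3 / 2 * a 2 - 2 / 3 * (L * s) := by
    linear_combination (r₅ + 4 * h₄) / 6
  have h₁ : a 1 = a 8 + L * c := by
    linear_combination -s * e₄ - c * hL - (a 1 - a 8) * h
  have h₇ : a 7 = q * (1 / 2 + s / 4) - a 2 * c + L * c / 2 - 2 * a 6 := by
    linear_combination -(c * e₃ - s * e₂) / 2 + h₁ / 2 +
      (2 * a 0 + a 1 - 8 * a 5 - 4 * a 6 - 2 * a 7 - a 8) / 2 * h - (1 + s / 2) / 2 * hq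
  have r₂ : -(q * c) / 2 - 4 * a 2 - 2 * a 2 * s - 2 * a 3 + L * s = 0 := by
    linear_combination c * e₂ + s * e₃ + h₄ + (4 * a 2 + 2 * a 3 + a 4) * h - c / 2 * hq
  have hL' : L = a 2 * (1 + s) + a 6 * c - 2 * p := by
    linear_combination hL + e₁ + 2 * hp
  have h₈ : a 8 = -(3 * a 0 - 27 * a 5 - 2 * (L * c) + 18 * a 6 - 12 * a 7) / 6 := by
    linear_combination (r₆ + 2 * h₁) / 6
  have hker : reducedSystem s c *ᵥ ![p, q, a 2, a 6] = 0 := by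
    simp only [h₁, h₈, h₀, h₅, h₄, h₃, h₇, hL'] at e₀ e₇ e₈
    rw [h₃, hL'] at r₂
    ext i
    fin_cases i <;> simp [reducedSystem, Matrix.mulVec, dotProduct, Fin.sum_univ_succ]
    · linear_combination 12 * e₀ - 14 * s * a 6 * h
    · linear_combination 6 * r₂
    · linear_combination 3 * e₇ - ((-15 + 36 * c + 256 * s) * p + (-6 - 9 * s) * q +
        (72 + 18 * c + 64 * s - 18 * s * c - 128 * s ^ 2) * a 2 +
        (12 - 18 * c ^ 2 - 128 * s * c + 60 * s ^ 2) * a 6) * h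
    · linear_combination 3 / 2 * e₈ - ((15 - 36 * c + 64 * s) * p + (6 + 9 * s) * q +
        (18 - 18 * c + 16 * s + 18 * s * c - 32 * s ^ 2) * a 2 +
        (-12 + 18 * c ^ 2 - 32 * s * c - 60 * s ^ 2) * a 6) * h
  have hz := eq_zero_of_mulVec_eq_zero (reducedSystem_det_ne_zero h) hker
  have hp₀ : p = 0 := congrFun hz 0
  have hq₀ : q = 0 := congrFun hz 1
  have z₂ : a 2 = 0 := congrFun hz 2
  have z₆ : a 6 = 0 := congrFun hz 3
  have hL₀ : L = 0 := by rw [hL', hp₀, z₂, z₆]; ring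
  have z₀ : a 0 = 0 := by rw [h₀, hp₀, hq₀]; ring
  have z₅ : a 5 = 0 := by rw [h₅, hp₀, hq₀]; ring
  have z₄ : a 4 = 0 := by rw [h₄, hL₀]; ring
  have z₃ : a 3 = 0 := by rw [h₃, hL₀, z₂]; ring
  have z₇ : a 7 = 0 := by rw [h₇, hL₀, z₂, hq₀, z₆]; ring
  have z₈ : a 8 = 0 := by rw [h₈, z₀, z₅, hL₀, z₆, z₇]; ring
  have z₁ : a 1 = 0 := by rw [h₁, z₈, hL₀]; ring
  intro i
  fin_cases i <;> assumption

lemma contDiff_F : ContDiff ℝ (⊤ : ℕ∞) (fun p : ℝ × ℝ => F p.1 p.2) := by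
  simp only [F, Rmat_mulVec]
  refine contDiff_pi.2 fun i => ?_
  fin_cases i <;> simp [v] <;> fun_prop

lemma Rmat_add_two_pi (x : ℝ) : Rmat (x + 2 * π) = Rmat x := by
  have hs (k : ℕ) : sin (k * (x + 2 * π)) = sin (k * x) := by
    rw [mul_add, sin_add_nat_mul_two_pi]
  have hc (k : ℕ) : cos (k * (x + 2 * π)) = cos (k * x) := by
    rw [mul_add, cos_add_nat_mul_two_pi]
  have hs₂ := hs 2
  have hs₃ := hs 3
  have hs₄ := hs 4
  have hc₂ := hc 2
  have hc₃ := hc 3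
  have hc₄ := hc 4
  push_cast at hs₂ hs₃ hs₄ hc₂ hc₃ hc₄
  simp only [Rmat, sin_add_two_pi, cos_add_two_pi, hs₂, hs₃, hs₄, hc₂, hc₃, hc₄]

lemma v_add_two_pi (y : ℝ) : v (y + 2 * π) = v y := by
  have hs : sin (2 * (y + 2 * π)) = sin (2 * y) := by
    simp [sin_two_mul]
  have hc : cos (2 * (y + 2 * π)) = cos (2 * y) := by
    simp [cos_two_mul]
  simp only [v, sin_add_two_pi, cos_add_two_pi, hs, hc]

/-- `F` is 3-free: at every point the nine vectors of partial
derivatives of orders 1, 2 and 3 are linearly independent in `ℝ⁹` (the critical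
dimension `q₍₂,₃₎ = C(2+3,3) − 1 = 9`). Moreover `F` is smooth and `2π`-periodic in
each variable, hence induces a smooth 3-free map of the 2-torus `T²` into `ℝ⁹`. -/
theorem F_three_free :
    (∀ x y : ℝ, LinearIndependent ℝ
      ![deriv (fun t => F t y) x,
        deriv (fun t => F x t) y,
        deriv (fun t => deriv (fun s => F s y) t) x,
        deriv (fun t => deriv (fun s => F s t) x) y,
        deriv (fun t => deriv (fun s => F x s) t) y,
        deriv (fun r => deriv (fun t => deriv (fun s => F s y) t) r) x,
        deriv (fun r => deriv (fun t => deriv (fun s => F s r) t) x) y,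
        deriv (fun r => deriv (fun t => deriv (fun s => F s t) x) r) y,
        deriv (fun r => deriv (fun t => deriv (fun s => F x s) t) r) y])
    ∧ ContDiff ℝ (⊤ : ℕ∞) (fun p : ℝ × ℝ => F p.1 p.2)
    ∧ (∀ x y : ℝ, F (x + 2 * π) y = F x y ∧ F x (y + 2 * π) = F x y) := by
  refine ⟨fun x y => ?_, contDiff_F, fun x y => ⟨by rw [F, F, Rmat_add_two_pi],
    by rw [F, F, v_add_two_pi]⟩⟩
  have hy (t : ℝ) : deriv (fun s => Rmat x *ᵥ v s) t = Rmat x *ᵥ vDeriv t :=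
    (hasDerivAt_mulVec _ (hasDerivAt_v t)).deriv
  have hyy (t : ℝ) : deriv (fun s => Rmat x *ᵥ vDeriv s) t = Rmat x *ᵥ vDeriv₂ t :=
    (hasDerivAt_mulVec _ (hasDerivAt_vDeriv t)).deriv
  have hyyy : deriv (fun s => Rmat x *ᵥ vDeriv₂ s) y = Rmat x *ᵥ vDeriv₃ y :=
    (hasDerivAt_mulVec _ (hasDerivAt_vDeriv₂ y)).deriv
  have hxy (t : ℝ) : deriv (fun s => Rmat x *ᵥ rotGen *ᵥ v s) t =
      Rmat x *ᵥ rotGen *ᵥ vDeriv t :=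
    (hasDerivAt_mulVec _ (hasDerivAt_mulVec _ (hasDerivAt_v t))).deriv
  have hxyy : deriv (fun s => Rmat x *ᵥ rotGen *ᵥ vDeriv s) y =
      Rmat x *ᵥ rotGen *ᵥ vDeriv₂ y :=
    (hasDerivAt_mulVec _ (hasDerivAt_mulVec _ (hasDerivAt_vDeriv y))).deriv
  have hxxy : deriv (fun s => Rmat x *ᵥ rotGen *ᵥ rotGen *ᵥ v s) y =
      Rmat x *ᵥ rotGen *ᵥ rotGen *ᵥ vDeriv y :=
    (hasDerivAt_mulVec _ (hasDerivAt_mulVec _ (hasDerivAt_mulVec _ (hasDerivAt_v y)))).deriv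
  simp only [F, deriv_Rmat_mulVec, hy, hyy, hyyy, hxy, hxyy, hxxy]
  have hli := (jetFrame_linearIndependent y).map' (Rmat x).mulVecLin
    (LinearMap.ker_eq_bot.2 (Rmat_mulVec_injective x))
  convert hli using 1
  · ext i : 1
    fin_cases i <;> rfl
  · rfl
  · rfl
end

section
/- Define C : ℝ² → ℝ⁵ by C(u,θ) = (cos θ, sin θ, u cos 2θ, u sin 2θ, −u²/2) and W̃ : ℝ² → ℝ⁵ by W̃(r,θ) = (r cos θ, r sin θ, (r²/2)cos 2θ, (r²/2)sin 2θ, r²/2). Then there exist δ ∈ (0, 1/4) and a smooth map A : ℝ² → ℝ⁵ which is 2π-periodic in its second argument, such that: (1) A(u,θ) = C(u,θ) for all u ∈ [0,δ] and all θ; (2) A(u,θ) = W̃(2u,θ) for all u ∈ [1−δ, 1] and all θ; and (3) for every (u,θ) ∈ [0,1] × ℝ, the five vectors ∂_uA, ∂_θA, ∂_{uu}A, ∂_{uθ}A, ∂_{θθ}A ∈ ℝ⁵ are linearly independent. In other words, there is a smooth free map of the cylinder [0,1] × S¹ into ℝ⁵ equal to the signed-cylinder model C near u = 0 and to the polar model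 W̃(2u,θ) near u = 1. -/
open Real

/-- The signed-cylinder model `C(u,θ) = (cos θ, sin θ, u cos 2θ, u sin 2θ, −u²/2)`. -/
noncomputable def Cmodel (u θ : ℝ) : Fin 5 → ℝ :=
  ![cos θ, sin θ, u * cos (2 * θ), u * sin (2 * θ), -u ^ 2 / 2]

/-- The polar model `W̃(r,θ) = (r cos θ, r sin θ, (r²/2)cos 2θ, (r²/2)sin 2θ, r²/2)`. -/
noncomputable def Wmodel (r θ : ℝ) : Fin 5 → ℝ :=
  ![r * cos θ, r * sin θ, r ^ 2 / 2 * cos (2 * θ), r ^ 2 / 2 * sin (2 * θ), r ^ 2 / 2]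

/-- Freeness of an equivariant map of the cylinder with radial profiles `a`, `b` and height `h`
reduces to two scalar conditions on the profiles. -/
theorem linearIndependent_of_profile
    {a a₁ a₂ b b₁ b₂ h h₁ h₂ : ℝ → ℝ}
    (ha : ∀ u, HasDerivAt a (a₁ u) u) (ha₁ : ∀ u, HasDerivAt a₁ (a₂ u) u)
    (hb : ∀ u, HasDerivAt b (b₁ u) u) (hb₁ : ∀ u, HasDerivAt b₁ (b₂ u) u)
    (hh : ∀ u, HasDerivAt h (h₁ u) u) (hh₁ : ∀ u, HasDerivAt h₁ (h₂ u) u)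
    {A : ℝ → ℝ → Fin 5 → ℝ}
    (hA : A = fun u θ => ![a u * cos θ, a u * sin θ, b u * cos (2 * θ), b u * sin (2 * θ), h u])
    {u : ℝ} (θ : ℝ) (hD : a u * b₁ u - a₁ u * b u ≠ 0)
    (hE : h₁ u * (a u * b₂ u - 4 * a₂ u * b u) - h₂ u * (a u * b₁ u - 4 * a₁ u * b u) ≠ 0) :
    LinearIndependent ℝ
      ![deriv (fun u' => A u' θ) u,
        deriv (fun θ' => A u θ') θ,
        deriv (fun u' => deriv (fun u'' => A u'' θ) u') u,
        deriv (fun θ' => deriv (fun u' => A u' θ') u) θ,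
        deriv (fun θ' => deriv (fun θ'' => A u θ'') θ') θ] := by
  have hc2 : ∀ t, HasDerivAt (fun t => cos (2 * t)) (-(2 * sin (2 * t))) t := fun t => by
    have := ((hasDerivAt_id' t).const_mul 2).cos
    convert this using 1; ring
  have hs2 : ∀ t, HasDerivAt (fun t => sin (2 * t)) (2 * cos (2 * t)) t := fun t => by
    have := ((hasDerivAt_id' t).const_mul 2).sin
    convert this using 1; ring
  have e₁ : ∀ u θ, deriv (fun u' => A u' θ) u =
      ![a₁ u * cos θ, a₁ u * sin θ, b₁ u * cos (2 * θ), b₁ u * sin (2 * θ), h₁ u] := by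
    intro u θ
    subst hA
    refine HasDerivAt.deriv (hasDerivAt_pi.2 fun i => ?_)
    fin_cases i
    · exact (ha u).mul_const _
    · exact (ha u).mul_const _
    · exact (hb u).mul_const _
    · exact (hb u).mul_const _
    · exact hh u
  have e₂ : ∀ θ, deriv (fun θ' => A u θ') θ =
      ![a u * -sin θ, a u * cos θ, b u * -(2 * sin (2 * θ)), b u * (2 * cos (2 * θ)), 0] := by
    intro θ
    subst hA
    refine HasDerivAt.deriv (hasDerivAt_pi.2 fun i => ?_)
    fin_cases i
    · exact (hasDerivAt_cos θ).const_mul _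
    · exact (hasDerivAt_sin θ).const_mul _
    · exact (hc2 θ).const_mul _
    · exact (hs2 θ).const_mul _
    · exact hasDerivAt_const _ _
  have e₃ : deriv (fun u' => deriv (fun u'' => A u'' θ) u') u =
      ![a₂ u * cos θ, a₂ u * sin θ, b₂ u * cos (2 * θ), b₂ u * sin (2 * θ), h₂ u] := by
    simp only [e₁]
    refine HasDerivAt.deriv (hasDerivAt_pi.2 fun i => ?_)
    fin_cases i
    · exact (ha₁ u).mul_const _
    · exact (ha₁ u).mul_const _
    · exact (hb₁ u).mul_const _
    · exact (hb₁ u).mul_const _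
    · exact hh₁ u
  have e₄ : deriv (fun θ' => deriv (fun u' => A u' θ') u) θ =
      ![a₁ u * -sin θ, a₁ u * cos θ, b₁ u * -(2 * sin (2 * θ)), b₁ u * (2 * cos (2 * θ)), 0] := by
    simp only [e₁]
    refine HasDerivAt.deriv (hasDerivAt_pi.2 fun i => ?_)
    fin_cases i
    · exact (hasDerivAt_cos θ).const_mul _
    · exact (hasDerivAt_sin θ).const_mul _
    · exact (hc2 θ).const_mul _
    · exact (hs2 θ).const_mul _
    · exact hasDerivAt_const _ _
  have e₅ : deriv (fun θ' => deriv (fun θ'' => A u θ'') θ') θ =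
      ![a u * -cos θ, a u * -sin θ, b u * -(2 * (2 * cos (2 * θ))),
        b u * (2 * -(2 * sin (2 * θ))), 0] := by
    simp only [e₂]
    refine HasDerivAt.deriv (hasDerivAt_pi.2 fun i => ?_)
    fin_cases i
    · exact (hasDerivAt_sin θ).neg.const_mul _
    · exact (hasDerivAt_cos θ).const_mul _
    · exact ((hs2 θ).const_mul 2).neg.const_mul _
    · exact ((hc2 θ).const_mul 2).const_mul _
    · exact hasDerivAt_const _ _
  rw [e₁, e₂, e₃, e₄, e₅, Fintype.linearIndependent_iff]
  intro x hx
  have p0 := congrFun hx 0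
  have p1 := congrFun hx 1
  have p2 := congrFun hx 2
  have p3 := congrFun hx 3
  have p4 := congrFun hx 4
  simp [Fin.sum_univ_five] at p0 p1 p2 p3 p4
  have cs := sin_sq_add_cos_sq θ
  have cs2 := sin_sq_add_cos_sq (2 * θ)
  generalize cos (2 * θ) = C2 at *
  generalize sin (2 * θ) = S2 at *
  generalize cos θ = C at *
  generalize sin θ = S at *
  have q0 : x 0 * a₁ u + x 2 * a₂ u - x 4 * a u = 0 := by
    linear_combination C * p0 + S * p1 - (x 0 * a₁ u + x 2 * a₂ u - x 4 * a u) * cs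
  have q1 : x 1 * a u + x 3 * a₁ u = 0 := by
    linear_combination -S * p0 + C * p1 - (x 1 * a u + x 3 * a₁ u) * cs
  have q2 : x 0 * b₁ u + x 2 * b₂ u - 4 * x 4 * b u = 0 := by
    linear_combination C2 * p2 + S2 * p3 - (x 0 * b₁ u + x 2 * b₂ u - 4 * x 4 * b u) * cs2
  have q3 : x 1 * b u + x 3 * b₁ u = 0 := by
    linear_combination (-S2 * p2 + C2 * p3) / 2 - (x 1 * b u + x 3 * b₁ u) * cs2
  have x3 : x 3 = 0 := by
    refine (mul_eq_zero.1 ?_).resolve_right hD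
    linear_combination a u * q3 - b u * q1
  have x1 : x 1 = 0 := by
    refine (mul_eq_zero.1 ?_).resolve_right hD
    linear_combination b₁ u * q1 - a₁ u * q3
  have x0 : x 0 = 0 := by
    refine (mul_eq_zero.1 ?_).resolve_right hE
    linear_combination (a u * b₂ u - 4 * a₂ u * b u) * p4 - h₂ u * (a u * q2 - 4 * b u * q0)
  have x2 : x 2 = 0 := by
    refine (mul_eq_zero.1 ?_).resolve_right hE
    linear_combination h₁ u * (a u * q2 - 4 * b u * q0) - (a u * b₁ u - 4 * a₁ u * b u) * p4
  have x4 : x 4 = 0 := by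
    rw [x0, x2] at q0 q2
    by_contra hne
    have za : a u = 0 := by
      have : x 4 * a u = 0 := by linarith
      exact (mul_eq_zero.1 this).resolve_left hne
    have zb : b u = 0 := by
      have : x 4 * b u = 0 := by linarith
      exact (mul_eq_zero.1 this).resolve_left hne
    exact hD (by rw [za, zb]; ring)
  intro i
  fin_cases i <;> assumption

theorem Real.smoothTransition_add_one_sub (x : ℝ) :
    smoothTransition x + smoothTransition (1 - x) = 1 := by
  have := (smoothTransition.pos_denom x).ne'
  have h := (smoothTransition.pos_denom (1 - x)).ne'
  unfold smoothTransition
  rw [sub_sub_cancel] at *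
  field_simp
  ring

/-- The smooth transition satisfies a logistic differential equation with rate at least `8`. -/
theorem Real.smoothTransition_exists_hasDerivAt (x : ℝ) :
    ∃ d, HasDerivAt smoothTransition d x ∧
      8 * smoothTransition x * (1 - smoothTransition x) ≤ d := by
  have hE : ∀ y, HasDerivAt expNegInvGlue (y⁻¹ ^ 2 * expNegInvGlue y) y := fun y => by
    simpa using expNegInvGlue.hasDerivAt_polynomial_eval_inv_mul 1 y
  have hS := smoothTransition.pos_denom x
  have h1 : HasDerivAt (fun y => expNegInvGlue (1 - y))
      (-((1 - x)⁻¹ ^ 2 * expNegInvGlue (1 - x))) x := by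
    have := (hE (1 - x)).comp x ((hasDerivAt_id' x).const_sub 1)
    simpa [Function.comp_def] using this
  refine ⟨_, (hE x).div ((hE x).add h1) hS.ne', ?_⟩
  have key : 8 * (expNegInvGlue x * expNegInvGlue (1 - x)) ≤
      (x⁻¹ ^ 2 + (1 - x)⁻¹ ^ 2) * (expNegInvGlue x * expNegInvGlue (1 - x)) := by
    rcases le_or_gt x 0 with h | h
    · simp [expNegInvGlue.zero_of_nonpos h]
    rcases le_or_gt 1 x with h' | h'
    · simp [expNegInvGlue.zero_of_nonpos (sub_nonpos.2 h')]
    gcongr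
    · exact mul_nonneg (expNegInvGlue.nonneg _) (expNegInvGlue.nonneg _)
    have h0 : 0 < 1 - x := by linarith
    have hp : x * x⁻¹ = 1 := mul_inv_cancel₀ h.ne'
    have hq : (1 - x) * (1 - x)⁻¹ = 1 := mul_inv_cancel₀ h0.ne'
    have tx : x⁻¹ ≥ 4 - 4 * x := by
      have : 0 ≤ x⁻¹ * (2 * x - 1) ^ 2 := by positivity
      nlinarith
    have ty : (1 - x)⁻¹ ≥ 4 * x := by
      have : 0 ≤ (1 - x)⁻¹ * (2 * x - 1) ^ 2 := by positivity
      nlinarith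
    nlinarith [sq_nonneg (x⁻¹ - (1 - x)⁻¹)]
  unfold smoothTransition
  rw [le_div_iff₀ (by positivity)]
  generalize expNegInvGlue x = p at *
  generalize expNegInvGlue (1 - x) = q at *
  calc _ = 8 * (p * q) := by field_simp; ring
    _ ≤ _ := key
    _ = _ := by ring

/-- A smooth step of width `w` together with its first two antiderivatives, which agree with
`x` and `x ^ 2 / 2`, up to a small constant, to the right of the transition. -/
theorem exists_smooth_ramp {w : ℝ} (hw : 0 < w) :
    ∃ (H ψ σ σ' : ℝ → ℝ) (e : ℝ), ContDiff ℝ (⊤ : ℕ∞) H ∧ ContDiff ℝ (⊤ : ℕ∞) ψ ∧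
      (∀ x, HasDerivAt H (ψ x) x) ∧ (∀ x, HasDerivAt ψ (σ x) x) ∧
      (∀ x, HasDerivAt σ (σ' x) x) ∧ (∀ x, 0 ≤ σ x ∧ σ x ≤ 1) ∧
      (∀ x, 8 * σ x * (1 - σ x) ≤ w * σ' x) ∧
      (∀ x ≤ -(w / 2), H x = 0 ∧ ψ x = 0 ∧ σ x = 0 ∧ σ' x = 0) ∧
      (∀ x, w / 2 ≤ x → H x = x ^ 2 / 2 + e ∧ ψ x = x ∧ σ x = 1 ∧ σ' x = 0) ∧
      (∀ x ≤ w / 2, 0 ≤ ψ x ∧ ψ x ≤ w / 2) ∧ |e| ≤ w ^ 2 := by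
  set σ : ℝ → ℝ := fun x => smoothTransition (x / w + 1 / 2) with hσ
  have hσc : ContDiff ℝ (⊤ : ℕ∞) σ :=
    smoothTransition.contDiff.comp ((contDiff_id.div_const w).add contDiff_const)
  have hσ0 : ∀ x ≤ -(w / 2), σ x = 0 := fun x hx => by
    refine smoothTransition.zero_of_nonpos ?_
    have : x / w ≤ -(1 / 2) := by rw [div_le_iff₀ hw]; linarith
    linarith
  have hσ1 : ∀ x, w / 2 ≤ x → σ x = 1 := fun x hx => by
    refine smoothTransition.one_of_one_le ?_
    have : 1 / 2 ≤ x / w := by rw [le_div_iff₀ hw]; linarith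
    linarith
  have hσn : ∀ x, 0 ≤ σ x := fun x => smoothTransition.nonneg _
  have hσl : ∀ x, σ x ≤ 1 := fun x => smoothTransition.le_one _
  have hσs : ∀ x, σ x + σ (-x) = 1 := fun x => by
    rw [← smoothTransition_add_one_sub (x / w + 1 / 2)]
    simp only [hσ]
    congr 2
    ring
  choose d hd hd8 using smoothTransition_exists_hasDerivAt
  set σ' : ℝ → ℝ := fun x => d (x / w + 1 / 2) / w with hσ'
  have hσd : ∀ x, HasDerivAt σ (σ' x) x := fun x => by
    have := (hd (x / w + 1 / 2)).comp x (((hasDerivAt_id' x).div_const w).add_const (1 / 2))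
    exact this.congr_deriv (mul_one_div _ _)
  have hσ8 : ∀ x, 8 * σ x * (1 - σ x) ≤ w * σ' x := fun x => by
    have := hd8 (x / w + 1 / 2)
    simp only [hσ']
    rwa [mul_div_cancel₀ _ hw.ne']
  set ψ : ℝ → ℝ := fun x => ∫ t in (-(w / 2))..x, σ t with hψ
  have hψd : ∀ x, HasDerivAt ψ (σ x) x := fun x =>
    intervalIntegral.integral_hasDerivAt_right (hσc.continuous.intervalIntegrable _ _)
      (hσc.continuous.stronglyMeasurableAtFilter _ _) hσc.continuous.continuousAt
  have hψc : ContDiff ℝ (⊤ : ℕ∞) ψ := by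
    refine contDiff_infty_iff_deriv.2 ⟨fun x => (hψd x).differentiableAt, ?_⟩
    rwa [show deriv ψ = σ from funext fun x => (hψd x).deriv]
  have hψm : Monotone ψ := monotone_of_deriv_nonneg (fun x => (hψd x).differentiableAt)
    fun x => by rw [(hψd x).deriv]; exact hσn x
  have hψ0 : ∀ x ≤ -(w / 2), ψ x = 0 := fun x hx => by
    simp only [hψ]
    rw [intervalIntegral.integral_congr (g := fun _ => 0)]
    · simp
    · intro t ht
      rw [Set.uIcc_of_ge hx] at ht
      exact hσ0 t ht.2
  have hψs : ∀ x, ψ x - ψ (-x) - x = 0 := by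
    have hder : ∀ x, HasDerivAt (fun x => ψ x - ψ (-x) - x) 0 x := fun x => by
      have := ((hψd x).sub ((hψd (-x)).comp x (hasDerivAt_neg x))).sub (hasDerivAt_id' x)
      rwa [show σ x - σ (-x) * -1 - 1 = 0 by linarith [hσs x]] at this
    intro x
    have := is_const_of_deriv_eq_zero (fun x => (hder x).differentiableAt)
      (fun x => (hder x).deriv) x 0
    simpa using this
  have hψ1 : ∀ x, w / 2 ≤ x → ψ x = x := fun x hx => by
    have := hψs x
    rw [hψ0 (-x) (by linarith)] at this
    linarith
  have hψb : ∀ x ≤ w / 2, 0 ≤ ψ x ∧ ψ x ≤ w / 2 := fun x hx => by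
    refine ⟨?_, (hψm hx).trans_eq (hψ1 _ le_rfl)⟩
    rcases le_total x (-(w / 2)) with h | h
    · exact (hψ0 x h).ge
    · exact (hψ0 _ le_rfl).ge.trans (hψm h)
  set H : ℝ → ℝ := fun x => ∫ t in (-(w / 2))..x, ψ t with hH
  have hHd : ∀ x, HasDerivAt H (ψ x) x := fun x =>
    intervalIntegral.integral_hasDerivAt_right (hψc.continuous.intervalIntegrable _ _)
      (hψc.continuous.stronglyMeasurableAtFilter _ _) hψc.continuous.continuousAt
  have hHc : ContDiff ℝ (⊤ : ℕ∞) H := by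
    refine contDiff_infty_iff_deriv.2 ⟨fun x => (hHd x).differentiableAt, ?_⟩
    rwa [show deriv H = ψ from funext fun x => (hHd x).deriv]
  have hH0 : ∀ x ≤ -(w / 2), H x = 0 := fun x hx => by
    simp only [hH]
    rw [intervalIntegral.integral_congr (g := fun _ => 0)]
    · simp
    · intro t ht
      rw [Set.uIcc_of_ge hx] at ht
      exact hψ0 t ht.2
  have hH1 : ∀ x, w / 2 ≤ x → H x = x ^ 2 / 2 + (H (w / 2) - w ^ 2 / 8) := fun x hx => by
    have hs : H x - H (w / 2) = ∫ t in (w / 2)..x, ψ t :=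
      intervalIntegral.integral_interval_sub_left (hψc.continuous.intervalIntegrable _ _)
        (hψc.continuous.intervalIntegrable _ _)
    rw [intervalIntegral.integral_congr (g := fun t => t), integral_id] at hs
    · linarith
    · intro t ht
      rw [Set.uIcc_of_le hx] at ht
      exact hψ1 t ht.1
  have hHb : 0 ≤ H (w / 2) ∧ H (w / 2) ≤ w ^ 2 / 2 := by
    have hle : -(w / 2) ≤ w / 2 := by linarith
    constructor
    · exact intervalIntegral.integral_nonneg hle fun t ht => (hψb t ht.2).1
    · have := intervalIntegral.integral_mono_on (μ := MeasureTheory.volume) hle (hψc.continuous.intervalIntegrable _ _)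
        (continuous_const.intervalIntegrable _ _) fun t ht => (hψb t ht.2).2
      rw [intervalIntegral.integral_const, smul_eq_mul] at this
      exact this.trans_eq (by ring)
  have hσ'n : ∀ x, σ x = 0 ∨ σ x = 1 → σ' x = 0 := fun x hx => by
    refine IsLocalExtr.hasDerivAt_eq_zero ?_ (hσd x)
    rcases hx with hx | hx
    · exact Or.inl (Filter.Eventually.of_forall fun y => hx.le.trans (hσn y))
    · exact Or.inr (Filter.Eventually.of_forall fun y => (hσl y).trans hx.ge)
  refine ⟨H, ψ, σ, σ', H (w / 2) - w ^ 2 / 8, hHc, hψc, hHd, hψd, hσd,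
    fun x => ⟨hσn x, hσl x⟩, hσ8, fun x hx => ⟨hH0 x hx, hψ0 x hx, hσ0 x hx, ?_⟩,
    fun x hx => ⟨hH1 x hx, hψ1 x hx, hσ1 x hx, ?_⟩, hψb, ?_⟩
  · exact hσ'n x (Or.inl (hσ0 x hx))
  · exact hσ'n x (Or.inr (hσ1 x hx))
  · rw [abs_le]
    constructor <;> nlinarith [sq_nonneg w]

/-- The second freeness condition on the transition layer of the first profile, where the
logistic lower bound on `t'` dominates. -/
theorem freeness_pos_of_logistic {K u y t t' : ℝ} (hK1 : 113 ≤ K) (hK2 : K ≤ 114)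
    (hu1 : 0.4995 ≤ u) (hu2 : u ≤ 0.5005) (hy0 : 0 ≤ y) (hy1 : y ≤ 1 / 2000)
    (ht0 : 0 ≤ t) (ht1 : t ≤ 1) (ht' : 8000 * (t * (1 - t)) ≤ t') :
    0 < (-u + K * y) * (4 * t - 6 * u * t') - (-1 + K * t) * (1 + 2 * y - 6 * u * t) := by
  have hf1 : 0.44 ≤ u - K * y := by nlinarith
  have hf2 : u - K * y ≤ 0.51 := by nlinarith
  have hm : 0 ≤ t * (1 - t) := mul_nonneg ht0 (by linarith)
  have b1 : t' ≤ 6 * (u - K * y) * u * t' := by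
    have : 1 ≤ 6 * (u - K * y) * u := by nlinarith
    nlinarith
  have b2 : (u - K * y) * t ≤ 0.51 * t := by gcongr
  have b3 : (K * t - 1) * (2 * y - (6 * u - 3) * t) ≤ 0.5 * t + 0.004 := by
    have c1 : 2 * y - (6 * u - 3) * t ≤ 0.004 := by nlinarith
    have c2 : -0.003 ≤ 2 * y - (6 * u - 3) * t := by nlinarith
    have c3 : 0 ≤ K * t := by positivity
    have c4 : K * t ≤ 114 * t := by gcongr
    nlinarith
  have b4 : 224 * t ≤ (2 * K - 2) * t := by
    gcongr
    linarith
  have b5 : 3 * K * (t * (1 - t)) ≤ 342 * (t * (1 - t)) := by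
    gcongr
    linarith
  nlinarith

/-- there is a smooth free map of the cylinder `[0,1] × S¹` into `ℝ⁵`
equal to the signed-cylinder model `C` near `u = 0` and to the polar model
`W̃(2u,θ)` near `u = 1`. -/
theorem interpolation_collar_exists :
    ∃ δ : ℝ, δ ∈ Set.Ioo (0 : ℝ) (1 / 4) ∧
      ∃ A : ℝ → ℝ → Fin 5 → ℝ,
        ContDiff ℝ (⊤ : ℕ∞) (fun p : ℝ × ℝ => A p.1 p.2) ∧
        (∀ u θ : ℝ, A u (θ + 2 * π) = A u θ) ∧
        (∀ u ∈ Set.Icc (0 : ℝ) δ, ∀ θ : ℝ, A u θ = Cmodel u θ) ∧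
        (∀ u ∈ Set.Icc (1 - δ) (1 : ℝ), ∀ θ : ℝ, A u θ = Wmodel (2 * u) θ) ∧
        (∀ u ∈ Set.Icc (0 : ℝ) 1, ∀ θ : ℝ, LinearIndependent ℝ
          ![deriv (fun u' => A u' θ) u,
            deriv (fun θ' => A u θ') θ,
            deriv (fun u' => deriv (fun u'' => A u'' θ) u') u,
            deriv (fun θ' => deriv (fun u' => A u' θ') u) θ,
            deriv (fun θ' => deriv (fun θ'' => A u θ'') θ') θ]) := by
  obtain ⟨H, ψ, σ, σ', e, hHc, hψc, hHd, hψd, hσd, hσb, hσ8, hneg, hpos, hψb, he⟩ :=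
    exists_smooth_ramp (w := 1 / 1000) (by norm_num)
  norm_num at hσ8 hneg hpos hψb he
  obtain ⟨s, hs, hs1, hs2⟩ : ∃ s : ℝ, -0.2927 + 0.0987 * s + 5 * e = 0 ∧ 2.96 ≤ s ∧ s ≤ 2.97 := by
    rw [abs_le] at he
    refine ⟨(0.2927 - 5 * e) / 0.0987, by ring, ?_, ?_⟩
    · rw [le_div_iff₀ (by norm_num)]; linarith
    · rw [div_le_iff₀ (by norm_num)]; linarith
  set a : ℝ → ℝ := fun u => 1 + 2 * ψ (u - 1 / 2) with ha
  set h : ℝ → ℝ := fun u => -u ^ 2 / 2 + (88.6 + 8.4 * s) * H (u - 1 / 2)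
    - (87.6 + 9.4 * s) * H (u - 0.55) + (4 + s) * H (u - 0.97) with hh
  have shift : ∀ {f f' : ℝ → ℝ} (c : ℝ), (∀ x, HasDerivAt f (f' x) x) →
      ∀ u, HasDerivAt (fun u => f (u - c)) (f' (u - c)) u := fun c hf u =>
    (hf (u - c)).comp_sub_const u c
  have hac : ContDiff ℝ (⊤ : ℕ∞) a := by fun_prop
  have hhc : ContDiff ℝ (⊤ : ℕ∞) h := by fun_prop
  have had : ∀ u, HasDerivAt a (2 * σ (u - 1 / 2)) u := fun u =>
    ((shift _ hψd u).const_mul 2).const_add 1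
  have had' : ∀ u, HasDerivAt (fun u => 2 * σ (u - 1 / 2)) (2 * σ' (u - 1 / 2)) u := fun u =>
    (shift _ hσd u).const_mul 2
  have hbd : ∀ u, HasDerivAt (fun u => u * a u) (a u + u * (2 * σ (u - 1 / 2))) u := fun u => by
    have := (hasDerivAt_id' u).mul (had u)
    rwa [one_mul] at this
  have hbd' : ∀ u, HasDerivAt (fun u => a u + u * (2 * σ (u - 1 / 2)))
      (2 * σ (u - 1 / 2) + (2 * σ (u - 1 / 2) + u * (2 * σ' (u - 1 / 2)))) u := fun u => by
    have := (had u).add ((hasDerivAt_id' u).mul (had' u))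
    rwa [one_mul] at this
  have hhd : ∀ u, HasDerivAt h (-u + (88.6 + 8.4 * s) * ψ (u - 1 / 2)
      - (87.6 + 9.4 * s) * ψ (u - 0.55) + (4 + s) * ψ (u - 0.97)) u := fun u => by
    have h2 : HasDerivAt (fun u : ℝ => -u ^ 2 / 2) (-u) u := by
      have := ((hasDerivAt_pow 2 u).neg).div_const 2
      exact this.congr_deriv (by norm_num; ring)
    exact ((h2.add ((shift _ hHd u).const_mul _)).sub ((shift _ hHd u).const_mul _)).add
      ((shift _ hHd u).const_mul _)
  have hhd' : ∀ u, HasDerivAt (fun u => -u + (88.6 + 8.4 * s) * ψ (u - 1 / 2)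
      - (87.6 + 9.4 * s) * ψ (u - 0.55) + (4 + s) * ψ (u - 0.97))
      (-1 + (88.6 + 8.4 * s) * σ (u - 1 / 2)
      - (87.6 + 9.4 * s) * σ (u - 0.55) + (4 + s) * σ (u - 0.97)) u := fun u =>
    ((((hasDerivAt_id' u).neg).add ((shift _ hψd u).const_mul _)).sub
      ((shift _ hψd u).const_mul _)).add ((shift _ hψd u).const_mul _)
  refine ⟨1 / 100, by norm_num, fun u θ => ![a u * cos θ, a u * sin θ, (u * a u) * cos (2 * θ),
    (u * a u) * sin (2 * θ), h u], ?_, ?_, ?_, ?_, ?_⟩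
  · rw [contDiff_pi]
    intro i
    fin_cases i <;> simp <;> fun_prop
  · intro u θ
    beta_reduce
    rw [show 2 * (θ + 2 * π) = 2 * θ + 2 * π + 2 * π by ring]
    simp only [cos_add_two_pi, sin_add_two_pi]
  · intro u hu θ
    have hu' := hu.2
    obtain ⟨p0, p1, -⟩ := hneg (u - 1 / 2) (by linarith)
    obtain ⟨q0, -⟩ := hneg (u - 0.55) (by linarith)
    obtain ⟨r0, -⟩ := hneg (u - 0.97) (by linarith)
    simp only [ha, hh, p0, p1, q0, r0, Cmodel]
    simp
  · intro u hu θ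
    have hu' := hu.1
    obtain ⟨p0, p1, -⟩ := hpos (u - 1 / 2) (by linarith)
    obtain ⟨q0, -⟩ := hpos (u - 0.55) (by linarith)
    obtain ⟨r0, -⟩ := hpos (u - 0.97) (by linarith)
    have e1 : a u = 2 * u := by simp only [ha, p1]; ring
    have e2 : h u = (2 * u) ^ 2 / 2 := by
      simp only [hh, p0, q0, r0]
      linear_combination hs
    have e3 : u * a u = (2 * u) ^ 2 / 2 := by rw [e1]; ring
    simp only [e1, e2, Wmodel]
    rw [← e3, e1]
  · intro u hu θ
    obtain ⟨hu0, hu1⟩ := hu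
    have ha0 : 0 < a u := by
      simp only [ha]
      rcases le_total u (1 / 2) with h1 | h1
      · linarith [(hψb (u - 1 / 2) (by linarith)).1]
      · rcases le_total (u - 1 / 2) (1 / 2000) with h2 | h2
        · linarith [(hψb (u - 1 / 2) h2).1]
        · linarith [(hpos (u - 1 / 2) h2).2.1]
    refine linearIndependent_of_profile had had' hbd hbd' hhd hhd' rfl θ ?_ ?_
    · have : 0 < a u ^ 2 := by positivity
      exact (this.trans_eq (by ring)).ne'
    refine (lt_of_lt_of_eq (mul_pos ha0 (?_ : 0 < (-u + (88.6 + 8.4 * s) * ψ (u - 1 / 2)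
      - (87.6 + 9.4 * s) * ψ (u - 0.55) + (4 + s) * ψ (u - 0.97))
        * (4 * σ (u - 1 / 2) - 6 * u * σ' (u - 1 / 2))
      - (-1 + (88.6 + 8.4 * s) * σ (u - 1 / 2)
      - (87.6 + 9.4 * s) * σ (u - 0.55) + (4 + s) * σ (u - 0.97))
        * (a u - 6 * u * σ (u - 1 / 2)))) (by ring)).ne'
    rcases le_total u 0.5495 with h1 | h1
    · obtain ⟨-, q1, q2, -⟩ := hneg (u - 0.55) (by linarith)
      obtain ⟨-, r1, r2, -⟩ := hneg (u - 0.97) (by linarith)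
      rw [q1, q2, r1, r2]
      simp only [ha]
      rcases le_total u 0.4995 with h2 | h2
      · obtain ⟨-, p1, p2, p3⟩ := hneg (u - 1 / 2) (by linarith)
        rw [p1, p2, p3]
        norm_num
      rcases le_total u 0.5005 with h3 | h3
      · have hψ2 := hψb (u - 1 / 2) (by linarith)
        have hσ2 := hσb (u - 1 / 2)
        have hσ3 := hσ8 (u - 1 / 2)
        have := freeness_pos_of_logistic (K := 88.6 + 8.4 * s) (t' := σ' (u - 1 / 2)) (by linarith)
          (by linarith) h2 h3 hψ2.1 hψ2.2 hσ2.1 hσ2.2 (by linarith)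
        linarith
      · obtain ⟨-, p1, p2, p3⟩ := hpos (u - 1 / 2) (by linarith)
        rw [p1, p2, p3]
        have : 0.5005 * s ≤ u * s := mul_le_mul_of_nonneg_right h3 (by linarith)
        linarith
    · obtain ⟨-, p1, p2, p3⟩ := hpos (u - 1 / 2) (by linarith)
      simp only [ha]
      rw [p1, p2, p3]
      have hσq := hσb (u - 0.55)
      have hσr := hσb (u - 0.97)
      have hslope : -s ≤ -1 + (88.6 + 8.4 * s) * 1
          - (87.6 + 9.4 * s) * σ (u - 0.55) + (4 + s) * σ (u - 0.97) := by
        have : (87.6 + 9.4 * s) * σ (u - 0.55) ≤ (87.6 + 9.4 * s) * 1 :=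
          mul_le_mul_of_nonneg_left hσq.2 (by linarith)
        have : 0 ≤ (4 + s) * σ (u - 0.97) := mul_nonneg (by linarith) hσr.1
        linarith
      have hval : u * s < -u + (88.6 + 8.4 * s) * (u - 1 / 2)
          - (87.6 + 9.4 * s) * ψ (u - 0.55) + (4 + s) * ψ (u - 0.97) := by
        have hus : 0.5495 * s ≤ u * s := mul_le_mul_of_nonneg_right h1 (by linarith)
        have hus' : u * s ≤ 1 * s := mul_le_mul_of_nonneg_right hu1 (by linarith)
        rcases le_total u 0.5505 with h2 | h2
        · obtain ⟨-, r1, -⟩ := hneg (u - 0.97) (by linarith)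
          have hψq := hψb (u - 0.55) (by linarith)
          have : (87.6 + 9.4 * s) * ψ (u - 0.55) ≤ 120 * (1 / 2000) :=
            mul_le_mul (by linarith) hψq.2 hψq.1 (by norm_num)
          rw [r1]
          linarith
        · obtain ⟨-, q1, -⟩ := hpos (u - 0.55) (by linarith)
          have hψr : 0 ≤ ψ (u - 0.97) := by
            rcases le_total u 0.9705 with h3 | h3
            · exact (hψb (u - 0.97) (by linarith)).1
            · rw [(hpos (u - 0.97) (by linarith)).2.1]
              linarith
          have : 0 ≤ (4 + s) * ψ (u - 0.97) := mul_nonneg (by linarith) hψr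
          rw [q1]
          linarith
      have := mul_le_mul_of_nonneg_left hslope hu0
      generalize -u + (88.6 + 8.4 * s) * (u - 1 / 2)
        - (87.6 + 9.4 * s) * ψ (u - 0.55) + (4 + s) * ψ (u - 0.97) = g at *
      generalize -1 + (88.6 + 8.4 * s) * 1
        - (87.6 + 9.4 * s) * σ (u - 0.55) + (4 + s) * σ (u - 0.97) = g' at *
      linarith
end
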